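/- arXiv:2001.04089 — 3 statements merged into one kernel-verified Lean document; each statement's English description precedes it below -/
import Mathlib

section
/- Let V be a finite-dimensional module over the Lie superalgebra 𝔪Δ (superderivations of A_{m,n} with coefficients in the maximal ideal 𝔪 at the point (1,...,1;0,...,0)). Then there exists k ∈ ℕ such that 𝔪^k Δ · V = 0. -/
/-! ### A concrete model of `A_{m,n}` and of the Witt superalgebra `W_{m,n}`

`A_{m,n} = ℂ[t₁^{±1},…,t_m^{±1}] ⊗ Λ(ξ₁,…,ξ_n)` has basis the monomials `t^α ξ_I`,
indexed by `AIdx m n = (Fin m → ℤ) × Finset (Fin n)`.  The Witt superalgebra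
`W_{m,n}` of superderivations of `A_{m,n}` has basis `t^α ξ_I d_i` and
`t^α ξ_I ∂/∂ξ_j` (`d_i = t_i ∂/∂t_i`), indexed by
`WIdx m n = (Fin m → ℤ) × Finset (Fin n) × (Fin m ⊕ Fin n)`. -/

/-- Inversion count: number of pairs `(a,b) ∈ I × J` with `a > b`. -/
def tauF {n : ℕ} (I J : Finset (Fin n)) : ℕ :=
  ((I ×ˢ J).filter fun p => p.2 < p.1).card

/-- The sign arising from `ξ_I · ξ_J = ε(I,J) ξ_{I ∪ J}`:  `(-1)^{τ(I,J)}` when `I, J`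
are disjoint and `0` otherwise. -/
noncomputable def epsF {n : ℕ} (I J : Finset (Fin n)) : ℂ :=
  if Disjoint I J then (-1 : ℂ) ^ tauF I J else 0

/-- Index set of the monomial basis `t^α ξ_I` of `A_{m,n}`. -/
abbrev AIdx (m n : ℕ) := (Fin m → ℤ) × Finset (Fin n)

/-- The underlying vector space of `A_{m,n}`. -/
abbrev ASp (m n : ℕ) := AIdx m n →₀ ℂ

/-- Index set of the basis `t^α ξ_I ∂` (`∂ = d_i` or `∂/∂ξ_j`) of `W_{m,n}`. -/
abbrev WIdx (m n : ℕ) := (Fin m → ℤ) × Finset (Fin n) × (Fin m ⊕ Fin n)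

/-- The underlying vector space of `W_{m,n}`. -/
abbrev WSp (m n : ℕ) := WIdx m n →₀ ℂ

/-- Product of two monomials of `A_{m,n}`. -/
noncomputable def mulMono {m n : ℕ} (u v : AIdx m n) : ASp m n :=
  epsF u.2 v.2 • Finsupp.single (u.1 + v.1, u.2 ∪ v.2) 1

/-- The (supercommutative) multiplication of `A_{m,n}`, as a bilinear map. -/
noncomputable def mulA (m n : ℕ) : ASp m n →ₗ[ℂ] ASp m n →ₗ[ℂ] ASp m n :=
  Finsupp.lsum ℂ fun u => LinearMap.toSpanSingleton ℂ _
    (Finsupp.lsum ℂ fun v => LinearMap.toSpanSingleton ℂ _ (mulMono u v))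

/-- A monomial of `A_{m,n}` multiplied with a basis element of `W_{m,n}`. -/
noncomputable def smulMonoW {m n : ℕ} (u : AIdx m n) (w : WIdx m n) : WSp m n :=
  epsF u.2 w.2.1 • Finsupp.single (u.1 + w.1, u.2 ∪ w.2.1, w.2.2) 1

/-- The action of `A_{m,n}` on `W_{m,n} = A_{m,n} Δ` by multiplication, bilinear. -/
noncomputable def smulAW (m n : ℕ) : ASp m n →ₗ[ℂ] WSp m n →ₗ[ℂ] WSp m n :=
  Finsupp.lsum ℂ fun u => LinearMap.toSpanSingleton ℂ _
    (Finsupp.lsum ℂ fun w => LinearMap.toSpanSingleton ℂ _ (smulMonoW u w))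

/-- The scalar produced when the derivation part `c` (`d_i` or `∂/∂ξ_j`) hits the
monomial `t^β ξ_J`. -/
noncomputable def dCoeff {m n : ℕ} (c : Fin m ⊕ Fin n) (β : Fin m → ℤ) (J : Finset (Fin n)) : ℂ :=
  match c with
  | Sum.inl i => (β i : ℂ)
  | Sum.inr j => if j ∈ J then (-1 : ℂ) ^ ((J.filter (· < j)).card) else 0

/-- The `ξ`-part of the monomial after applying the derivation part `c`. -/
def dSet {m n : ℕ} (c : Fin m ⊕ Fin n) (J : Finset (Fin n)) : Finset (Fin n) :=
  match c with
  | Sum.inl _ => J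
  | Sum.inr j => J.erase j

/-- The basis superderivation `t^α ξ_I ∂` (index `u`) applied to the monomial
`t^β ξ_J` (index `v`), as an element of `A_{m,n}`. -/
noncomputable def derMono {m n : ℕ} (u : WIdx m n) (v : AIdx m n) : ASp m n :=
  dCoeff u.2.2 v.1 v.2 • mulMono (u.1, u.2.1) (v.1, dSet u.2.2 v.2)

/-- The parity of a basis element `t^α ξ_I ∂` of `W_{m,n}`: `|I|` plus the parity of
the derivation part. -/
def parWIdx {m n : ℕ} (u : WIdx m n) : ℕ :=
  u.2.1.card + (match u.2.2 with | Sum.inl _ => 0 | Sum.inr _ => 1)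

/-- Attach a derivation part `b` to an element of `A_{m,n}`: `a ↦ a ∂_b`. -/
noncomputable def attachD {m n : ℕ} (b : Fin m ⊕ Fin n) : ASp m n →ₗ[ℂ] WSp m n :=
  Finsupp.lmapDomain ℂ ℂ (fun a => (a.1, a.2, b))

/-- The superbracket of two basis elements `x = t^α ξ_I ∂_a`, `y = t^β ξ_J ∂_b`:
`[x, y] = x(t^β ξ_J) ∂_b − (−1)^{|x||y|} y(t^α ξ_I) ∂_a`. -/
noncomputable def bracketMono {m n : ℕ} (u v : WIdx m n) : WSp m n :=
  attachD v.2.2 (derMono u (v.1, v.2.1)) -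
    ((-1 : ℂ) ^ (parWIdx u * parWIdx v)) • attachD u.2.2 (derMono v (u.1, u.2.1))

/-- The superbracket of `W_{m,n}`, as a bilinear map. -/
noncomputable def bracketW (m n : ℕ) : WSp m n →ₗ[ℂ] WSp m n →ₗ[ℂ] WSp m n :=
  Finsupp.lsum ℂ fun u => LinearMap.toSpanSingleton ℂ _
    (Finsupp.lsum ℂ fun v => LinearMap.toSpanSingleton ℂ _ (bracketMono u v))

/-- The `ℤ^m`-graded component `(W_{m,n})_α`, spanned by `t^α ξ_I d_i` and
`t^α ξ_I ∂/∂ξ_j`. -/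
noncomputable def Wgr (m n : ℕ) (α : Fin m → ℤ) : Submodule ℂ (WSp m n) :=
  Submodule.span ℂ
    {w | ∃ (I : Finset (Fin n)) (c : Fin m ⊕ Fin n), w = Finsupp.single (α, I, c) 1}

/-- The (`ℤ₂`-)homogeneous component of `W_{m,n}` of parity `p`. -/
noncomputable def Wpar (m n : ℕ) (p : ℕ) : Submodule ℂ (WSp m n) :=
  Submodule.span ℂ
    {w | ∃ u : WIdx m n, parWIdx u % 2 = p % 2 ∧ w = Finsupp.single u 1}

/-- Generators of the maximal ideal `𝔪` of `A_{m,n}` at the point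
`(1,…,1;0,…,0)`: the elements `t^α − 1` and the monomials `t^β ξ_I` with `I ≠ ∅`. -/
def mGen (m n : ℕ) : Set (ASp m n) :=
  {a | ∃ α : Fin m → ℤ,
      a = Finsupp.single (α, (∅ : Finset (Fin n))) 1 - Finsupp.single (0, ∅) 1} ∪
  {a | ∃ (β : Fin m → ℤ) (I : Finset (Fin n)), I ≠ ∅ ∧ a = Finsupp.single (β, I) 1}

/-- The powers `𝔪^k` of the maximal ideal `𝔪 ⊆ A_{m,n}` (with `𝔪^0 = A_{m,n}`). -/
noncomputable def mPow (m n : ℕ) : ℕ → Submodule ℂ (ASp m n)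
  | 0 => ⊤
  | k + 1 => Submodule.span ℂ
      {a | ∃ x ∈ Submodule.span ℂ (mGen m n), ∃ y ∈ mPow m n k, a = mulA m n x y}

/-- The Lie supersubalgebra `𝔪^k Δ` of `W_{m,n}`, consisting of superderivations with
coefficients in `𝔪^k`; in particular `mPowD m n 1` is `𝔪Δ`. -/
noncomputable def mPowD (m n : ℕ) (k : ℕ) : Submodule ℂ (WSp m n) :=
  Submodule.span ℂ
    {w | ∃ a ∈ mPow m n k, ∃ c : Fin m ⊕ Fin n,
        w = smulAW m n a (Finsupp.single (0, ∅, c) 1)}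

namespace WittSuper

open AddMonoidAlgebra (induction_linear)

/-- The ring `ℂ[t₁^{±1},…,t_m^{±1}]` of Laurent polynomials. -/
abbrev Laurent (m : ℕ) := AddMonoidAlgebra ℂ (Fin m → ℤ)

variable {m n : ℕ}

/-- The monomial `t^α`. -/
noncomputable abbrev mono (α : Fin m → ℤ) : Laurent m := AddMonoidAlgebra.single α 1

theorem mono_mul_mono (α β : Fin m → ℤ) : mono α * mono β = mono (α + β) := by
  simp [mono]

theorem mono_zero : mono (0 : Fin m → ℤ) = 1 := rfl

theorem laurent_hom_ext {M : Type*} [AddCommMonoid M] [Module ℂ M] {f g : Laurent m →ₗ[ℂ] M}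
    (h : ∀ α, f (mono α) = g (mono α)) : f = g := by
  refine LinearMap.ext fun p => ?_
  induction p using induction_linear with
  | zero => simp
  | add p q hp hq => simp [hp, hq]
  | single α c =>
    have : (AddMonoidAlgebra.single α c : Laurent m) = c • mono α := by simp [mono]
    rw [this, map_smul, map_smul, h]

/-- The linear map on Laurent polynomials with prescribed values on the monomials. -/
noncomputable def onMono {M : Type*} [AddCommMonoid M] [Module ℂ M] (f : (Fin m → ℤ) → M) :
    Laurent m →ₗ[ℂ] M :=
  Finsupp.lsum ℂ (fun α => LinearMap.toSpanSingleton ℂ M (f α)) ∘ₗ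
    (AddMonoidAlgebra.coeffLinearEquiv ℂ).toLinearMap

@[simp]
theorem onMono_mono {M : Type*} [AddCommMonoid M] [Module ℂ M] (f : (Fin m → ℤ) → M)
    (α : Fin m → ℤ) : onMono f (mono α) = f α := by
  simp [onMono, mono]

/-- The map `p ↦ p ξ_J`. -/
noncomputable def toA (J : Finset (Fin n)) : Laurent m →ₗ[ℂ] ASp m n :=
  onMono fun β => Finsupp.single (β, J) 1

/-- The map `p ↦ p ξ_J ∂_c`. -/
noncomputable def toW (J : Finset (Fin n)) (c : Fin m ⊕ Fin n) : Laurent m →ₗ[ℂ] WSp m n :=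
  onMono fun β => Finsupp.single (β, J, c) 1

/-- The exponent of `t_i` if `c` stands for `d_i`, and `0` if `c` stands for `∂/∂ξ_j`. -/
def weight (c : Fin m ⊕ Fin n) : (Fin m → ℤ) →+ ℂ :=
  match c with
  | Sum.inl i => (Int.castAddHom ℂ).comp (Pi.evalAddMonoidHom _ i)
  | Sum.inr _ => 0

/-- The restriction of `∂_c` to Laurent polynomials. -/
noncomputable def der (c : Fin m ⊕ Fin n) : Derivation ℂ (Laurent m) (Laurent m) :=
  Derivation.mk' (onMono fun β => weight c β • mono β) (by
    intro p q
    have key : (onMono fun β => weight c β • mono β) ∘ₗ LinearMap.mulLeft ℂ p =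
        LinearMap.mulLeft ℂ p ∘ₗ (onMono fun β => weight c β • mono β) +
        LinearMap.mulRight ℂ ((onMono fun β => weight c β • mono β) p) := by
      refine laurent_hom_ext fun β => ?_
      have key₂ : (onMono fun β => weight c β • mono β) ∘ₗ LinearMap.mulRight ℂ (mono β) =
          weight c β • LinearMap.mulRight ℂ (mono β) +
          LinearMap.mulRight ℂ (mono β) ∘ₗ (onMono fun β => weight c β • mono β) := by
        refine laurent_hom_ext fun α => ?_
        simp [-AddMonoidAlgebra.smul_single, add_smul, add_comm]
      have := LinearMap.congr_fun key₂ p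
      simpa [-AddMonoidAlgebra.smul_single, mul_comm (mono β)] using this
    have := LinearMap.congr_fun key q
    simpa [mul_comm] using this)

@[simp]
theorem der_mono (c : Fin m ⊕ Fin n) (β : Fin m → ℤ) :
    der c (mono β) = weight c β • mono β := by
  simp [der, -AddMonoidAlgebra.smul_single]

@[simp]
theorem epsF_empty_left (J : Finset (Fin n)) : epsF ∅ J = 1 := by simp [epsF, tauF]

@[simp]
theorem epsF_empty_right (J : Finset (Fin n)) : epsF J ∅ = 1 := by simp [epsF, tauF]

theorem dCoeff_empty (c : Fin m ⊕ Fin n) (α : Fin m → ℤ) : dCoeff c α ∅ = weight c α := by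
  cases c <;> simp [dCoeff, weight]

theorem dSet_empty (c : Fin m ⊕ Fin n) : dSet c ∅ = ∅ := by
  cases c <;> simp [dSet]

theorem bracketMono_inl (i : Fin m) (α β : Fin m → ℤ) (J : Finset (Fin n))
    (c : Fin m ⊕ Fin n) :
    bracketMono (α, ∅, Sum.inl i) (β, J, c) =
      weight (Sum.inl i : Fin m ⊕ Fin n) β • Finsupp.single (α + β, J, c) (1 : ℂ) -
        weight c α • Finsupp.single (α + β, J, Sum.inl i) 1 := by
  have hw : dCoeff (Sum.inl i : Fin m ⊕ Fin n) β J = weight (Sum.inl i : Fin m ⊕ Fin n) β := rfl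
  have hs : dSet (Sum.inl i : Fin m ⊕ Fin n) J = J := rfl
  simp only [bracketMono, derMono, mulMono, dCoeff_empty, dSet_empty, hw, hs, map_smul, attachD,
    Finsupp.lmapDomain_apply, Finsupp.mapDomain_single, epsF_empty_left, epsF_empty_right,
    Finset.empty_union, Finset.union_empty, one_smul, parWIdx, Finset.card_empty, zero_add,
    zero_mul, pow_zero, add_comm β α]

theorem bracketW_toW (i : Fin m) (g : Laurent m) (J : Finset (Fin n)) (c : Fin m ⊕ Fin n)
    (f : Laurent m) :
    bracketW m n (toW ∅ (Sum.inl i) g) (toW J c f) =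
      toW J c (g * der (Sum.inl i : Fin m ⊕ Fin n) f) - toW J (Sum.inl i) (f * der c g) := by
  have key : (bracketW m n ∘ₗ toW ∅ (Sum.inl i)).compl₂ (toW J c) +
        ((LinearMap.mul ℂ (Laurent m)).compl₂ (der c).toLinearMap).flip.compr₂
          (toW J (Sum.inl i)) =
      ((LinearMap.mul ℂ (Laurent m)).compl₂
          (der (Sum.inl i : Fin m ⊕ Fin n)).toLinearMap).compr₂ (toW J c) := by
    refine laurent_hom_ext fun α => laurent_hom_ext fun β => ?_
    simp [-AddMonoidAlgebra.smul_single, -AddMonoidAlgebra.single_mul_single,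
      -Finsupp.smul_single, mono_mul_mono, toW, bracketW, bracketMono_inl, add_comm β α]
  exact eq_sub_of_add_eq (LinearMap.congr_fun (LinearMap.congr_fun key g) f)

theorem mulA_single_toA (α : Fin m → ℤ) (I J : Finset (Fin n)) (p : Laurent m) :
    mulA m n (Finsupp.single (α, I) 1) (toA J p) = epsF I J • toA (I ∪ J) (mono α * p) := by
  have key : mulA m n (Finsupp.single (α, I) 1) ∘ₗ toA J =
      epsF I J • (toA (I ∪ J) ∘ₗ LinearMap.mulLeft ℂ (mono α)) := by
    refine laurent_hom_ext fun β => ?_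
    simp [-AddMonoidAlgebra.single_mul_single, mono_mul_mono, toA, mulA, mulMono]
  exact LinearMap.congr_fun key p

theorem smulAW_toA (J : Finset (Fin n)) (c : Fin m ⊕ Fin n) (p : Laurent m) :
    smulAW m n (toA J p) (Finsupp.single (0, ∅, c) 1) = toW J c p := by
  have key : (smulAW m n).flip (Finsupp.single (0, ∅, c) 1) ∘ₗ toA J = toW J c := by
    refine laurent_hom_ext fun β => ?_
    simp [toA, toW, smulAW, smulMonoW]
  exact LinearMap.congr_fun key p

/-- The local coordinate `t_i - 1`. -/
noncomputable def coord (i : Fin m) : Laurent m := mono (Pi.single i 1) - 1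

theorem toW_mem_mPowD_one (i : Fin m) (J : Finset (Fin n)) (c : Fin m ⊕ Fin n) (q : Laurent m) :
    toW J c (coord i * q) ∈ mPowD m n 1 := by
  refine Submodule.subset_span ⟨toA J (coord i * q), Submodule.subset_span
    ⟨_, Submodule.subset_span (Or.inl ⟨Pi.single i 1, rfl⟩), toA J q, Submodule.mem_top, ?_⟩,
    c, (smulAW_toA ..).symm⟩
  simp [-AddMonoidAlgebra.single_mul_single, mulA_single_toA, coord, sub_mul, mono_zero]

theorem toW_mem_Wpar (J : Finset (Fin n)) (c : Fin m ⊕ Fin n) (p : Laurent m) :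
    toW J c p ∈ Wpar m n (parWIdx ((0 : Fin m → ℤ), J, c)) := by
  induction p using induction_linear with
  | zero => simp
  | add p q hp hq => simpa using add_mem hp hq
  | single β a =>
    have : (AddMonoidAlgebra.single β a : Laurent m) = a • mono β := by simp [mono]
    rw [this, map_smul]
    exact Submodule.smul_mem _ _ (Submodule.subset_span ⟨(β, J, c), rfl, by simp [toW]⟩)

/-- The ideal of Laurent polynomials vanishing at `(1,…,1)`. -/
noncomputable def augIdeal (m : ℕ) : Ideal (Laurent m) := Ideal.span (Set.range coord)

theorem mono_sub_one_mem (α : Fin m → ℤ) : mono α - 1 ∈ augIdeal m := by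
  let S : AddSubgroup (Fin m → ℤ) :=
    { carrier := {α | mono α - 1 ∈ augIdeal m}
      zero_mem' := by simp [mono_zero]
      add_mem' := by
        intro α β hα hβ
        have : mono (α + β) - 1 = mono α * (mono β - 1) + (mono α - 1) := by
          rw [← mono_mul_mono]; ring
        simp only [Set.mem_ofPred_eq] at *
        rw [this]
        exact add_mem (Ideal.mul_mem_left _ _ hβ) hα
      neg_mem' := by
        intro α hα
        have h : mono (-α) * mono α = (1 : Laurent m) := by
          rw [mono_mul_mono, neg_add_cancel, mono_zero]
        have : mono (-α) - 1 = -mono (-α) * (mono α - 1) := by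
          linear_combination h
        simp only [Set.mem_ofPred_eq] at *
        rw [this]
        exact Ideal.mul_mem_left _ _ hα }
  change α ∈ S
  rw [← Finset.univ_sum_single α]
  refine sum_mem fun i _ => ?_
  have : Pi.single i (α i) = α i • (Pi.single i 1 : Fin m → ℤ) := by
    rw [← Pi.single_smul]; simp
  rw [this]
  exact zsmul_mem (show Pi.single i 1 ∈ S from Ideal.subset_span ⟨i, rfl⟩) _

theorem mPow_le (k : ℕ) :
    mPow m n k ≤ ⨆ J : Finset (Fin n),
      (((augIdeal m) ^ (k - J.card)).restrictScalars ℂ).map (toA J) := by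
  induction k with
  | zero =>
    intro a _
    induction a using Finsupp.induction_linear with
    | zero => exact zero_mem _
    | add a b ha hb => exact add_mem (ha trivial) (hb trivial)
    | single u c =>
      refine Submodule.mem_iSup_of_mem u.2 ⟨c • mono u.1, by simp, ?_⟩
      rw [map_smul]
      simp [toA]
  | succ k ih =>
    refine Submodule.span_le.2 ?_
    rintro _ ⟨x, hx, y, hy, rfl⟩
    generalize hT : (⨆ J : Finset (Fin n),
      (((augIdeal m) ^ (k + 1 - J.card)).restrictScalars ℂ).map (toA J)) = T
    have hmem : ∀ (J : Finset (Fin n)) (p : Laurent m), p ∈ augIdeal m ^ (k + 1 - J.card) →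
        toA J p ∈ T := fun J p hp => hT ▸ Submodule.mem_iSup_of_mem J ⟨p, hp, rfl⟩
    suffices h : Submodule.span ℂ (mGen m n) ≤ T.comap ((mulA m n).flip y) from h hx
    refine Submodule.span_le.2 fun x hx => ?_
    suffices h : (⨆ J : Finset (Fin n),
        (((augIdeal m) ^ (k - J.card)).restrictScalars ℂ).map (toA J)) ≤
          T.comap (mulA m n x) from h (ih hy)
    refine iSup_le fun J => ?_
    rintro _ ⟨p, hp, rfl⟩
    have hp : p ∈ augIdeal m ^ (k - J.card) := hp
    rcases hx with ⟨α, rfl⟩ | ⟨β, I, hI, rfl⟩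
    · have : mulA m n (Finsupp.single (α, ∅) 1 - Finsupp.single (0, ∅) 1) (toA J p) =
          toA J ((mono α - 1) * p) := by
        simp [-AddMonoidAlgebra.single_mul_single, mulA_single_toA, sub_mul, mono_zero]
      rw [Submodule.mem_comap, this]
      refine hmem J _ (Ideal.pow_le_pow_right (n := k - J.card + 1) (by omega) ?_)
      rw [pow_succ']
      exact Ideal.mul_mem_mul (mono_sub_one_mem α) hp
    · rw [Submodule.mem_comap, mulA_single_toA]
      by_cases hd : Disjoint I J
      · refine Submodule.smul_mem _ _ (hmem _ _ (Ideal.mul_mem_left _ _ ?_))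
        have := Finset.card_pos.2 (Finset.nonempty_iff_ne_empty.2 hI)
        refine Ideal.pow_le_pow_right ?_ hp
        rw [Finset.card_union_of_disjoint hd]
        omega
      · simp [epsF, hd]

theorem exists_mPowD_le (K : Submodule ℂ (WSp m n)) (N : Fin m → ℕ)
    (hK : ∀ i J c q, toW J c (coord i ^ N i * q) ∈ K) : ∃ k, mPowD m n k ≤ K := by
  obtain ⟨r, hr⟩ : ∃ r, augIdeal m ^ r ≤ Ideal.span (Set.range fun i => coord i ^ N i) := by
    refine Ideal.exists_pow_le_of_le_radical_of_fg (Ideal.span_le.2 ?_)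
      (Submodule.fg_span (Set.finite_range _))
    rintro _ ⟨i, rfl⟩
    exact ⟨N i, Ideal.subset_span ⟨i, rfl⟩⟩
  refine ⟨r + n, Submodule.span_le.2 ?_⟩
  rintro _ ⟨a, ha, c, rfl⟩
  suffices h : (⨆ J : Finset (Fin n),
      (((augIdeal m) ^ (r + n - J.card)).restrictScalars ℂ).map (toA J)) ≤
        K.comap ((smulAW m n).flip (Finsupp.single (0, ∅, c) 1)) from h (mPow_le _ ha)
  refine iSup_le fun J => ?_
  rintro _ ⟨p, hp, rfl⟩
  rw [Submodule.mem_comap, LinearMap.flip_apply, smulAW_toA]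
  have hJ : J.card ≤ n := by simpa using J.card_le_univ
  have hp : p ∈ Ideal.span (Set.range fun i => coord i ^ N i) :=
    hr (Ideal.pow_le_pow_right (by omega) hp)
  obtain ⟨f, rfl⟩ := Ideal.mem_span_range_iff_exists_fun.1 hp
  rw [map_sum]
  exact sum_mem fun i _ => by simpa only [mul_comm] using hK i J c (f i)

theorem exists_forall_eq_zero_of_commutator {R : Type*} [Ring R] [Algebra ℂ R]
    [FiniteDimensional ℂ R] (e : R) (x : ℕ → R) (h : ∀ j, e * x j - x j * e = (j : ℂ) • x j) :
    ∃ N, ∀ j ≥ N, x j = 0 := by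
  let f : Module.End ℂ R := LinearMap.mulLeft ℂ e - LinearMap.mulRight ℂ e
  have hfin : {j : ℕ | f.HasEigenvalue (j : ℂ)}.Finite :=
    f.finite_hasEigenvalue.preimage Nat.cast_injective.injOn
  obtain ⟨N, hN⟩ := hfin.bddAbove
  refine ⟨N + 1, fun j hj => ?_⟩
  by_contra hx
  have : f.HasEigenvalue (j : ℂ) :=
    Module.End.hasEigenvalue_of_hasEigenvector
      ⟨Module.End.mem_eigenspace_iff.2 (by simpa [f] using h j), hx⟩
  have := hN this
  omega

theorem weight_single (c : Fin m ⊕ Fin n) (i : Fin m) :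
    weight c (Pi.single i 1) = if c = Sum.inl i then 1 else 0 := by
  rcases c with j | j
  · by_cases h : j = i
    · subst h; simp [weight]
    · simp [weight, h]
  · simp [weight]

theorem der_coord (c : Fin m ⊕ Fin n) (i : Fin m) :
    der c (coord i) = if c = Sum.inl i then mono (Pi.single i 1) else 0 := by
  rw [coord, map_sub, der_mono, weight_single, Derivation.map_one_eq_zero, sub_zero]
  split_ifs
  · rw [one_smul]
  · rw [zero_smul]

/-- The coefficient of `(t_i - 1) ∂/∂t_i` with respect to `d_i`. -/
noncomputable def eulerCoeff (i : Fin m) : Laurent m := coord i * mono (-Pi.single i 1)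

theorem mono_mul_eulerCoeff (i : Fin m) : mono (Pi.single i 1) * eulerCoeff i = coord i := by
  have : mono (Pi.single i 1) * mono (-Pi.single i 1) = (1 : Laurent m) := by
    rw [mono_mul_mono, add_neg_cancel, mono_zero]
  rw [eulerCoeff]
  linear_combination coord i * this

theorem bracketW_euler (i : Fin m) (j : ℕ) :
    bracketW m n (toW ∅ (Sum.inl i) (eulerCoeff i))
        (toW ∅ (Sum.inl i) (coord i ^ j * eulerCoeff i)) =
      (j : ℂ) • toW ∅ (Sum.inl i) (coord i ^ j * eulerCoeff i) := by
  rw [bracketW_toW, ← map_sub, ← map_smul]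
  congr 1
  rw [Derivation.leibniz, Derivation.leibniz_pow, der_coord, if_pos rfl, Nat.cast_smul_eq_nsmul]
  simp only [smul_eq_mul, nsmul_eq_mul]
  rcases j with _ | j
  · simp
  · rw [Nat.add_sub_cancel]
    linear_combination (((j + 1 : ℕ) : Laurent m) * coord i ^ j * eulerCoeff i) *
      mono_mul_eulerCoeff i

theorem bracketW_sub_bracketW (i : Fin m) (h : Laurent m) (J : Finset (Fin n))
    (c : Fin m ⊕ Fin n) (f : Laurent m) :
    bracketW m n (toW ∅ (Sum.inl i) h) (toW J c (coord i * f)) -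
        bracketW m n (toW ∅ (Sum.inl i) (coord i * h)) (toW J c f) =
      (if c = Sum.inl i then (2 : ℂ) else 1) • toW J c (mono (Pi.single i 1) * h * f) := by
  rw [bracketW_toW, bracketW_toW, Derivation.leibniz, Derivation.leibniz, der_coord, der_coord,
    if_pos rfl]
  simp only [smul_eq_mul]
  split_ifs with hc
  · subst hc
    rw [← map_sub, ← map_sub, ← map_sub, ← map_smul, ofNat_smul_eq_nsmul, two_nsmul]
    congr 1
    ring
  · have h₁ : coord i * f * der c h - f * (coord i * der c h + h * 0) = 0 := by ring
    rw [one_smul, sub_sub_sub_comm, ← map_sub, ← map_sub, h₁, map_zero, sub_zero]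
    congr 1
    ring

end WittSuper

open WittSuper

/-- Let `V` be a finite-dimensional module over the Lie superalgebra `𝔪Δ` (the
superderivations of `A_{m,n}` with coefficients in the maximal ideal `𝔪` at
`(1,…,1;0,…,0)`), given by a `ℤ₂`-graded space `V` and an action map `ρ` which is
parity-compatible and sends superbrackets of homogeneous elements of `𝔪Δ` to
supercommutators.  Then there exists `k ∈ ℕ` with `𝔪^k Δ · V = 0`. -/
theorem stmt10 (m n : ℕ) (V : Type*) [AddCommGroup V] [Module ℂ V]
    [FiniteDimensional ℂ V]
    (gV : ZMod 2 → Submodule ℂ V) (hcompl : IsCompl (gV 0) (gV 1))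
    (ρ : WSp m n →ₗ[ℂ] Module.End ℂ V)
    (hcl : ∀ x ∈ mPowD m n 1, ∀ y ∈ mPowD m n 1, bracketW m n x y ∈ mPowD m n 1)
    (hpar : ∀ (p : ℕ) (x : WSp m n), x ∈ mPowD m n 1 → x ∈ Wpar m n p →
      ∀ q : ZMod 2, ∀ v ∈ gV q, ρ x v ∈ gV (q + (p : ZMod 2)))
    (hrep : ∀ (p q : ℕ) (x y : WSp m n), x ∈ mPowD m n 1 → y ∈ mPowD m n 1 →
      x ∈ Wpar m n p → y ∈ Wpar m n q →
      ρ (bracketW m n x y) = ρ x * ρ y - ((-1 : ℂ) ^ (p * q)) • (ρ y * ρ x)) :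
    ∃ k : ℕ, ∀ x ∈ mPowD m n k, ρ x = 0 := by
  have hker : ∀ i : Fin m, ∃ N, ∀ J c q, toW J c (coord i ^ N * q) ∈ LinearMap.ker ρ := by
    intro i
    have commutator (J : Finset (Fin n)) (c : Fin m ⊕ Fin n) (g f : Laurent m)
        (hg : coord i ∣ g) (hf : coord i ∣ f) :
        ρ (bracketW m n (toW ∅ (Sum.inl i) g) (toW J c f)) =
          ρ (toW ∅ (Sum.inl i) g) * ρ (toW J c f) - ρ (toW J c f) * ρ (toW ∅ (Sum.inl i) g) := by
      obtain ⟨g, rfl⟩ := hg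
      obtain ⟨f, rfl⟩ := hf
      have := hrep 0 (parWIdx ((0 : Fin m → ℤ), J, c)) _ _
        (toW_mem_mPowD_one i ∅ (Sum.inl i) g) (toW_mem_mPowD_one i J c f)
        (toW_mem_Wpar ∅ (Sum.inl i) _) (toW_mem_Wpar J c _)
      rwa [zero_mul, pow_zero, one_smul] at this
    have hdvd : coord i ∣ eulerCoeff i := Dvd.intro _ rfl
    obtain ⟨N, hN⟩ := exists_forall_eq_zero_of_commutator
      (ρ (toW ∅ (Sum.inl i) (eulerCoeff i)))
      (fun j => ρ (toW ∅ (Sum.inl i) (coord i ^ j * eulerCoeff i))) fun j => by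
        rw [← commutator _ _ _ _ hdvd (hdvd.mul_left _), bracketW_euler, map_smul]
    refine ⟨N + 2, fun J c q => ?_⟩
    have key := congrArg ρ (bracketW_sub_bracketW i (coord i ^ N * eulerCoeff i) J c (coord i * q))
    have hN₁ : ρ (toW ∅ (Sum.inl i) (coord i * (coord i ^ N * eulerCoeff i))) = 0 := by
      rw [← mul_assoc, ← pow_succ']
      exact hN (N + 1) (Nat.le_succ N)
    rw [map_sub, commutator _ _ _ _ (hdvd.mul_left _) (Dvd.intro _ rfl),
      commutator _ _ _ _ (Dvd.intro _ rfl) (Dvd.intro _ rfl), hN₁, hN N le_rfl, map_smul] at key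
    simp only [zero_mul, mul_zero, sub_zero] at key
    have hq : coord i ^ (N + 2) * q =
        mono (Pi.single i 1) * (coord i ^ N * eulerCoeff i) * (coord i * q) := by
      linear_combination (-(coord i ^ (N + 1) * q)) * mono_mul_eulerCoeff i
    rw [hq, LinearMap.mem_ker]
    refine (smul_eq_zero.1 key.symm).resolve_left ?_
    split_ifs <;> norm_num
  choose N hN using hker
  exact exists_mPowD_le (LinearMap.ker ρ) N hN
end

section
/- Let V be a finite-dimensional simple module over the Lie superalgebra 𝔪Δ. Then 𝔪²Δ · V = 0, so V factors through 𝔪Δ/𝔪²Δ ≅ 𝔤𝔩(m,n) and can be regarded as a simple 𝔤𝔩(m,n)-module. -/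
/-! ### The Laurent polynomial ring and its augmentation ideal -/

/-- The ring of Laurent polynomials in `m` variables. -/
abbrev Laurent (m : ℕ) := AddMonoidAlgebra ℂ (Fin m → ℤ)

namespace Laurent

variable {m : ℕ}

/-- The monomial `t^α`. -/
noncomputable def mono (α : Fin m → ℤ) : Laurent m := AddMonoidAlgebra.single α 1

/-- The variable `t_i`. -/
noncomputable def T (i : Fin m) : Laurent m := mono (Pi.single i 1)

/-- The inverse `t_i⁻¹` of a variable. -/
noncomputable def Tinv (i : Fin m) : Laurent m := mono (-Pi.single i 1)

lemma mono_zero : mono (0 : Fin m → ℤ) = 1 := rfl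

lemma mono_add (α β : Fin m → ℤ) : mono (α + β) = mono α * mono β := by
  simp [mono, AddMonoidAlgebra.single_mul_single]

lemma T_mul_Tinv (i : Fin m) : T i * Tinv i = 1 := by
  rw [T, Tinv, ← mono_add, add_neg_cancel, mono_zero]

/-- Linear maps out of the Laurent polynomials, defined on monomials. -/
noncomputable def liftMono {M : Type*} [AddCommMonoid M] [Module ℂ M]
    (f : (Fin m → ℤ) → M) : Laurent m →ₗ[ℂ] M :=
  Finsupp.linearCombination ℂ f ∘ₗ (AddMonoidAlgebra.coeffLinearEquiv ℂ).toLinearMap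

@[simp] lemma liftMono_mono {M : Type*} [AddCommMonoid M] [Module ℂ M]
    (f : (Fin m → ℤ) → M) (α : Fin m → ℤ) : liftMono f (mono α) = f α := by
  simp [liftMono, mono]

lemma single_eq_smul_mono (α : Fin m → ℤ) (r : ℂ) :
    (AddMonoidAlgebra.single α r : Laurent m) = r • mono α := by
  simp [mono]

lemma span_mono : Submodule.span ℂ (Set.range (mono (m := m))) = ⊤ := by
  refine eq_top_iff.2 fun p _ => ?_
  induction p using AddMonoidAlgebra.induction_linear with
  | zero => exact zero_mem _
  | add p q hp hq => exact add_mem (hp trivial) (hq trivial)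
  | single α r =>
    rw [single_eq_smul_mono]
    exact Submodule.smul_mem _ _ (Submodule.subset_span ⟨α, rfl⟩)

lemma hom_ext {M : Type*} [AddCommMonoid M] [Module ℂ M] {f g : Laurent m →ₗ[ℂ] M}
    (h : ∀ α, f (mono α) = g (mono α)) : f = g :=
  LinearMap.ext_on_range span_mono h

/-- The derivation `t_i ∂/∂t_i`. -/
noncomputable def deriv (i : Fin m) : Derivation ℂ (Laurent m) (Laurent m) :=
  Derivation.mk' (liftMono fun α => (α i : ℂ) • mono α) fun p q => by
    set D : Laurent m →ₗ[ℂ] Laurent m := liftMono fun α => (α i : ℂ) • mono α with hD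
    have key : (LinearMap.mul ℂ (Laurent m)).compr₂ D =
        (LinearMap.mul ℂ (Laurent m)).compl₂ D + (LinearMap.mul ℂ (Laurent m)).comp D := by
      refine hom_ext fun α => hom_ext fun β => ?_
      simp [hD, ← mono_add, ← add_smul, add_comm]
    simpa [mul_comm] using congr($key p q)

@[simp] lemma deriv_mono (i : Fin m) (α : Fin m → ℤ) :
    deriv i (mono α) = (α i : ℂ) • mono α :=
  liftMono_mono _ _

lemma deriv_T_self (i : Fin m) : deriv i (T i) = T i := by simp [T]

lemma deriv_Tinv_self (i : Fin m) : deriv i (Tinv i) = -Tinv i := by simp [Tinv]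

lemma deriv_T_of_ne {i l : Fin m} (h : l ≠ i) : deriv l (T i) = 0 := by simp [T, h]

lemma deriv_Tinv_of_ne {i l : Fin m} (h : l ≠ i) : deriv l (Tinv i) = 0 := by simp [Tinv, h]

/-- The element `t_i - 1`. -/
noncomputable def S (i : Fin m) : Laurent m := T i - 1

lemma deriv_S_self (i : Fin m) : deriv i (S i) = T i := by simp [S, deriv_T_self]

lemma deriv_S_of_ne {i l : Fin m} (h : l ≠ i) : deriv l (S i) = 0 := by
  simp [S, deriv_T_of_ne h]

lemma T_eq (i : Fin m) : T i = S i + 1 := by simp [S]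

/-- The ideal of Laurent polynomials vanishing at `(1, …, 1)`. -/
noncomputable def augIdeal (m : ℕ) : Ideal (Laurent m) := Ideal.span (Set.range S)

lemma S_mem (i : Fin m) : S i ∈ augIdeal m := Ideal.subset_span ⟨i, rfl⟩

lemma mono_sub_one_mem (α : Fin m → ℤ) : mono α - 1 ∈ augIdeal m := by
  let K : AddSubgroup (Fin m → ℤ) :=
    { carrier := {α | mono α - 1 ∈ augIdeal m}
      zero_mem' := by simp [mono_zero]
      add_mem' := fun {α β} hα hβ => by
        have : mono (α + β) - 1 = mono α * (mono β - 1) + (mono α - 1) := by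
          rw [mono_add]; ring
        rw [Set.mem_ofPred_eq, this]
        exact add_mem (Ideal.mul_mem_left _ _ hβ) hα
      neg_mem' := fun {α} hα => by
        have h : mono (-α) * mono α = 1 := by rw [← mono_add, neg_add_cancel, mono_zero]
        have : mono (-α) - 1 = -mono (-α) * (mono α - 1) := by linear_combination h
        rw [Set.mem_ofPred_eq, this]
        exact Ideal.mul_mem_left _ _ hα }
  change α ∈ K
  rw [← Finset.univ_sum_single α]
  refine sum_mem fun i _ => ?_
  have : (Pi.single i (α i) : Fin m → ℤ) = α i • Pi.single i 1 := by
    rw [← Pi.single_smul, smul_eq_mul, mul_one]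
  rw [this]
  exact K.zsmul_mem (S_mem i) _

/-- Evaluation at `(1, …, 1)`. -/
noncomputable def aug (m : ℕ) : Laurent m →ₐ[ℂ] ℂ :=
  AddMonoidAlgebra.lift ℂ ℂ (Fin m → ℤ) 1

@[simp] lemma aug_mono (α : Fin m → ℤ) : aug m (mono α) = 1 := by
  simp [aug, mono]

lemma aug_eq_zero {p : Laurent m} (hp : p ∈ augIdeal m) : aug m p = 0 := by
  have : augIdeal m ≤ RingHom.ker (aug m) := by
    rw [augIdeal, Ideal.span_le]
    rintro _ ⟨i, rfl⟩
    simp [S, T, RingHom.mem_ker]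
  exact this hp

/-- Powers of the augmentation ideal lower by at most one under a derivation. -/
lemma derivation_mem_pow (D : Derivation ℂ (Laurent m) (Laurent m)) :
    ∀ (k : ℕ) {p : Laurent m}, p ∈ augIdeal m ^ k → D p ∈ augIdeal m ^ (k - 1)
  | 0, _, _ => by simp
  | 1, _, _ => by simp
  | k + 2, p, hp => by
    rw [pow_succ] at hp
    refine Submodule.mul_induction_on hp (fun a ha b hb => ?_) fun a b ha hb => ?_
    · rw [Derivation.leibniz]
      refine add_mem (Ideal.mul_mem_right _ _ ?_) ?_
      · simpa using ha
      · rw [smul_eq_mul, mul_comm]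
        have := Ideal.mul_mem_mul (derivation_mem_pow D (k + 1) ha) hb
        rwa [Nat.add_sub_cancel, ← pow_succ] at this
    · rw [map_add]; exact add_mem ha hb

/-- The Euler derivation `∑ (t_i - 1) ∂/∂t_i`. -/
noncomputable def euler (m : ℕ) : Derivation ℂ (Laurent m) (Laurent m) :=
  ∑ i, (S i * Tinv i) • deriv i

lemma euler_apply (p : Laurent m) : euler m p = ∑ i, S i * Tinv i * deriv i p := by
  change Derivation.coeFnAddMonoidHom (∑ i : Fin m, (S i * Tinv i) • deriv i) p = _
  rw [map_sum, Finset.sum_apply]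
  rfl

lemma euler_S (i : Fin m) : euler m (S i) = S i := by
  rw [euler_apply, Finset.sum_eq_single i]
  · rw [deriv_S_self, mul_assoc, mul_comm (Tinv i), T_mul_Tinv, mul_one]
  · intro l _ hl
    rw [deriv_S_of_ne hl, mul_zero]
  · simp

lemma euler_mem (p : Laurent m) : euler m p ∈ augIdeal m := by
  rw [euler_apply]
  exact sum_mem fun i _ => Ideal.mul_mem_right _ _ (Ideal.mul_mem_right _ _ (S_mem i))

lemma euler_sub_mem {p : Laurent m} (hp : p ∈ augIdeal m) :
    euler m p - p ∈ augIdeal m ^ 2 := by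
  rw [augIdeal] at hp
  induction hp using Submodule.span_induction with
  | mem x hx => obtain ⟨i, rfl⟩ := hx; simp [euler_S]
  | zero => simp
  | add x y _ _ hx hy => rw [map_add, add_sub_add_comm]; exact add_mem hx hy
  | smul a x hx h =>
    have : euler m (a • x) - a • x = a * (euler m x - x) + x * euler m a := by
      simp only [smul_eq_mul, Derivation.leibniz]; ring
    rw [this]
    refine add_mem (Ideal.mul_mem_left _ _ h) ?_
    rw [pow_two]
    exact Ideal.mul_mem_mul hx (euler_mem a)

lemma euler_sub_smul_mem_pow (k : ℕ) {p : Laurent m} (hp : p ∈ augIdeal m ^ k) :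
    euler m p - (k : ℂ) • p ∈ augIdeal m ^ (k + 1) := by
  induction k generalizing p with
  | zero => simpa using euler_mem p
  | succ k ih =>
    rw [pow_succ] at hp
    refine Submodule.mul_induction_on hp (fun a ha b hb => ?_) fun a b ha hb => ?_
    · have : euler m (a * b) - ((k + 1 : ℕ) : ℂ) • (a * b)
          = a * (euler m b - b) + (euler m a - (k : ℂ) • a) * b := by
        simp only [smul_eq_mul, Derivation.leibniz, Algebra.smul_def, map_natCast]
        push_cast
        ring
      rw [this]
      refine add_mem ?_ ?_
      · have := Ideal.mul_mem_mul ha (euler_sub_mem hb)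
        rwa [← pow_add] at this
      · have := Ideal.mul_mem_mul (ih ha) hb
        rwa [← pow_succ] at this
    · rw [map_add, smul_add, add_sub_add_comm]; exact add_mem ha hb

lemma exists_pow_augIdeal_le (k : ℕ) :
    ∃ N, augIdeal m ^ N ≤ Ideal.span (Set.range fun i : Fin m => S i ^ k) := by
  refine Ideal.exists_pow_le_of_le_radical_of_fg ?_ ⟨Finset.univ.image S, by simp [augIdeal]⟩
  rw [augIdeal, Ideal.span_le]
  rintro _ ⟨i, rfl⟩
  exact ⟨k, Ideal.subset_span ⟨i, rfl⟩⟩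

end Laurent

/-! ### Homogeneous coordinates on `A_{m,n}` and `W_{m,n}` -/

section Coordinates

open Laurent

variable {m n : ℕ}

/-- The element `p ξ_I` of `A_{m,n}`. -/
noncomputable def coeffA (I : Finset (Fin n)) : Laurent m →ₗ[ℂ] ASp m n :=
  liftMono fun α => Finsupp.single (α, I) 1

/-- The element `p ξ_I ∂_c` of `W_{m,n}`. -/
noncomputable def coeffW (I : Finset (Fin n)) (c : Fin m ⊕ Fin n) : Laurent m →ₗ[ℂ] WSp m n :=
  liftMono fun α => Finsupp.single (α, I, c) 1

@[simp] lemma coeffA_mono (I : Finset (Fin n)) (α : Fin m → ℤ) :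
    coeffA I (mono α) = Finsupp.single (α, I) 1 := liftMono_mono _ _

@[simp] lemma coeffW_mono (I : Finset (Fin n)) (c : Fin m ⊕ Fin n) (α : Fin m → ℤ) :
    coeffW I c (mono α) = Finsupp.single (α, I, c) 1 := liftMono_mono _ _

lemma tauF_empty_right (I : Finset (Fin n)) : tauF I ∅ = 0 := by simp [tauF]

lemma tauF_empty_left (I : Finset (Fin n)) : tauF ∅ I = 0 := by simp [tauF]

@[simp] lemma epsF_empty_right (I : Finset (Fin n)) : epsF I ∅ = 1 := by
  simp [epsF, tauF_empty_right]

@[simp] lemma epsF_empty_left (I : Finset (Fin n)) : epsF ∅ I = 1 := by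
  simp [epsF, tauF_empty_left]

lemma tauF_singleton_erase (j : Fin n) (J : Finset (Fin n)) :
    tauF {j} (J.erase j) = (J.filter (· < j)).card := by
  unfold tauF
  refine Finset.card_bij' (fun p _ => p.2) (fun b _ => (j, b)) ?_ ?_ ?_ ?_
  · rintro ⟨a, b⟩; simp +contextual
  · intro b; simp +contextual [ne_of_lt]
  · rintro ⟨a, b⟩; simp +contextual
  · simp

lemma mulA_coeffA (I J : Finset (Fin n)) (p q : Laurent m) :
    mulA m n (coeffA I p) (coeffA J q) = epsF I J • coeffA (I ∪ J) (p * q) := by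
  have key : (mulA m n).compl₁₂ (coeffA I) (coeffA J) =
      epsF I J • (LinearMap.mul ℂ (Laurent m)).compr₂ (coeffA (I ∪ J)) := by
    refine hom_ext fun α => hom_ext fun β => ?_
    simp [mulA, mulMono, ← mono_add]
  simpa using congr($key p q)

lemma smulAW_coeffA (I : Finset (Fin n)) (c : Fin m ⊕ Fin n) (p : Laurent m) :
    smulAW m n (coeffA I p) (Finsupp.single (0, ∅, c) 1) = coeffW I c p := by
  have key : (smulAW m n).flip (Finsupp.single (0, ∅, c) 1) ∘ₗ coeffA I = coeffW I c := by
    refine hom_ext fun α => ?_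
    simp [smulAW, smulMonoW]
  simpa using congr($key p)

/-- The action of the derivation part `c` on the coefficient of `ξ_J`. -/
noncomputable def coeffDeriv (c : Fin m ⊕ Fin n) (J : Finset (Fin n)) :
    Laurent m →ₗ[ℂ] Laurent m :=
  match c with
  | Sum.inl i => (deriv i : Laurent m →ₗ[ℂ] Laurent m)
  | Sum.inr j => (if j ∈ J then (-1 : ℂ) ^ ((J.filter (· < j)).card) else 0) • LinearMap.id

lemma coeffDeriv_mono (c : Fin m ⊕ Fin n) (J : Finset (Fin n)) (β : Fin m → ℤ) :
    coeffDeriv c J (mono β) = dCoeff c β J • mono β := by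
  rcases c with i | j
  · simp [coeffDeriv, dCoeff]
  · rw [coeffDeriv, LinearMap.smul_apply, dCoeff, LinearMap.id_apply]

lemma bracketW_coeffW (I J : Finset (Fin n)) (b c : Fin m ⊕ Fin n) (p q : Laurent m) :
    bracketW m n (coeffW I b p) (coeffW J c q) =
      epsF I (dSet b J) • coeffW (I ∪ dSet b J) c (p * coeffDeriv b J q) -
      ((-1 : ℂ) ^ (parWIdx ((0 : Fin m → ℤ), I, b) * parWIdx ((0 : Fin m → ℤ), J, c))) •
        epsF J (dSet c I) • coeffW (J ∪ dSet c I) b (q * coeffDeriv c I p) := by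
  let F : Laurent m →ₗ[ℂ] Laurent m →ₗ[ℂ] WSp m n :=
    ((LinearMap.mul ℂ (Laurent m)).compl₂ (coeffDeriv b J)).compr₂ (coeffW (I ∪ dSet b J) c)
  let G : Laurent m →ₗ[ℂ] Laurent m →ₗ[ℂ] WSp m n :=
    (((LinearMap.mul ℂ (Laurent m)).compl₂ (coeffDeriv c I)).compr₂
      (coeffW (J ∪ dSet c I) b)).flip
  have key : (bracketW m n).compl₁₂ (coeffW I b) (coeffW J c) +
      ((-1 : ℂ) ^ (parWIdx ((0 : Fin m → ℤ), I, b) * parWIdx ((0 : Fin m → ℤ), J, c))) •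
        epsF J (dSet c I) • G = epsF I (dSet b J) • F := by
    refine hom_ext fun α => hom_ext fun β => ?_
    simp [F, G, bracketW, bracketMono, derMono, mulMono, attachD, coeffDeriv_mono, ← mono_add,
      parWIdx, -Finsupp.single_mul, add_comm β α, mul_comm]
  rw [eq_sub_iff_add_eq]
  simpa [F, G] using congr($key p q)

/-- The span of the `p ξ_I` with `p` vanishing to order `k - |I|`. -/
noncomputable def ordA (m n k : ℕ) : Submodule ℂ (ASp m n) :=
  Submodule.span ℂ {a | ∃ (I : Finset (Fin n)) (p : Laurent m),
    p ∈ augIdeal m ^ (k - I.card) ∧ a = coeffA I p}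

/-- The span of the `p ξ_I ∂_c` with `p` vanishing to order `k - |I|`. -/
noncomputable def ordW (m n k : ℕ) : Submodule ℂ (WSp m n) :=
  Submodule.span ℂ {w | ∃ (I : Finset (Fin n)) (c : Fin m ⊕ Fin n) (p : Laurent m),
    p ∈ augIdeal m ^ (k - I.card) ∧ w = coeffW I c p}

lemma coeffW_mem_ordW {k : ℕ} {I : Finset (Fin n)} (c : Fin m ⊕ Fin n) {p : Laurent m}
    (hp : p ∈ augIdeal m ^ (k - I.card)) : coeffW I c p ∈ ordW m n k :=
  Submodule.subset_span ⟨I, c, p, hp, rfl⟩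

lemma coeffA_mem_ordA {k : ℕ} {I : Finset (Fin n)} {p : Laurent m}
    (hp : p ∈ augIdeal m ^ (k - I.card)) : coeffA I p ∈ ordA m n k :=
  Submodule.subset_span ⟨I, p, hp, rfl⟩

lemma ordA_zero : ordA m n 0 = ⊤ := by
  refine eq_top_iff.2 fun a _ => ?_
  induction a using Finsupp.induction_linear with
  | zero => exact zero_mem _
  | add a b ha hb => exact add_mem (ha trivial) (hb trivial)
  | single u r =>
    obtain ⟨α, I⟩ := u
    have : (Finsupp.single (α, I) r : ASp m n) = r • coeffA I (mono α) := by simp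
    rw [this]
    exact Submodule.smul_mem _ _ (coeffA_mem_ordA (by simp))

lemma span_mGen_le : Submodule.span ℂ (mGen m n) ≤ ordA m n 1 := by
  rw [Submodule.span_le]
  rintro _ (⟨α, rfl⟩ | ⟨β, I, hI, rfl⟩)
  · have : (Finsupp.single (α, ∅) 1 - Finsupp.single (0, ∅) 1 : ASp m n) =
        coeffA ∅ (mono α - 1) := by simp [← mono_zero]
    rw [this]
    exact coeffA_mem_ordA (by simpa using mono_sub_one_mem α)
  · rw [← coeffA_mono]
    refine coeffA_mem_ordA ?_
    have : 1 - I.card = 0 := by have := Finset.card_pos.2 (Finset.nonempty_iff_ne_empty.2 hI); omega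
    simp [this]

lemma mulA_mem_ordA {k l : ℕ} {x y : ASp m n} (hx : x ∈ ordA m n k) (hy : y ∈ ordA m n l) :
    mulA m n x y ∈ ordA m n (k + l) := by
  rw [ordA] at hx hy
  induction hx, hy using Submodule.span_induction₂ with
  | mem_mem x y hx hy =>
    obtain ⟨I, p, hp, rfl⟩ := hx
    obtain ⟨J, q, hq, rfl⟩ := hy
    rw [mulA_coeffA]
    by_cases hd : Disjoint I J
    · refine Submodule.smul_mem _ _ (coeffA_mem_ordA ?_)
      have := Ideal.mul_mem_mul hp hq
      rw [← pow_add] at this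
      exact Ideal.pow_le_pow_right (by rw [Finset.card_union_of_disjoint hd]; omega) this
    · simp [epsF, hd]
  | zero_left => simp
  | zero_right => simp
  | add_left x y z _ _ _ h₁ h₂ => simpa using add_mem h₁ h₂
  | add_right x y z _ _ _ h₁ h₂ => simpa using add_mem h₁ h₂
  | smul_left r x y _ _ h => simpa using Submodule.smul_mem _ r h
  | smul_right r x y _ _ h => simpa using Submodule.smul_mem _ r h

lemma mPow_le_ordA (k : ℕ) : mPow m n k ≤ ordA m n k := by
  induction k with
  | zero => rw [ordA_zero]; exact le_top
  | succ k ih =>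
    rw [mPow, Submodule.span_le]
    rintro _ ⟨x, hx, y, hy, rfl⟩
    rw [add_comm]
    exact mulA_mem_ordA (span_mGen_le hx) (ih hy)

lemma mPowD_le_ordW (k : ℕ) : mPowD m n k ≤ ordW m n k := by
  rw [mPowD, Submodule.span_le]
  rintro _ ⟨a, ha, c, rfl⟩
  have key : ordA m n k ≤
      (ordW m n k).comap ((smulAW m n).flip (Finsupp.single (0, ∅, c) 1)) := by
    rw [ordA, Submodule.span_le]
    rintro _ ⟨I, p, hp, rfl⟩
    simpa [smulAW_coeffA] using coeffW_mem_ordW c hp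
  simpa using key (mPow_le_ordA k ha)

lemma coeffA_mem_span_mGen {I : Finset (Fin n)} {p : Laurent m}
    (hp : p ∈ augIdeal m ^ (1 - I.card)) : coeffA I p ∈ Submodule.span ℂ (mGen m n) := by
  rcases eq_or_ne I ∅ with rfl | hI
  · rw [Finset.card_empty, Nat.sub_zero, pow_one] at hp
    have key (q : Laurent m) : coeffA ∅ (q - aug m q • 1) ∈ Submodule.span ℂ (mGen m n) := by
      induction q using AddMonoidAlgebra.induction_linear with
      | zero => simp
      | add p q hp hq =>
        rw [map_add, add_smul, add_sub_add_comm, map_add]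
        exact add_mem hp hq
      | single α r =>
        rw [single_eq_smul_mono, map_smul, aug_mono, smul_assoc, one_smul, ← smul_sub, map_smul]
        refine Submodule.smul_mem _ _ (Submodule.subset_span (Or.inl ⟨α, ?_⟩))
        simp [← mono_zero]
    simpa [aug_eq_zero hp] using key p
  · have key : ⊤ ≤ (Submodule.span ℂ (mGen m n)).comap (coeffA I) := by
      rw [← span_mono, Submodule.span_le]
      rintro _ ⟨α, rfl⟩
      exact Submodule.subset_span (Or.inr ⟨α, I, hI, by simp⟩)
    exact key (Submodule.mem_top (x := p))

lemma ordW_one_le : ordW m n 1 ≤ mPowD m n 1 := by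
  rw [ordW, Submodule.span_le]
  rintro _ ⟨I, c, p, hp, rfl⟩
  refine Submodule.subset_span ⟨coeffA I p, Submodule.subset_span
    ⟨coeffA I p, coeffA_mem_span_mGen hp, coeffA ∅ 1, trivial, ?_⟩, c, (smulAW_coeffA I c p).symm⟩
  rw [mulA_coeffA]
  simp

lemma coeffW_mem_Wpar (I : Finset (Fin n)) (c : Fin m ⊕ Fin n) (p : Laurent m) :
    coeffW I c p ∈ Wpar m n (parWIdx ((0 : Fin m → ℤ), I, c)) := by
  have key : ⊤ ≤ (Wpar m n (parWIdx ((0 : Fin m → ℤ), I, c))).comap (coeffW I c) := by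
    rw [← span_mono, Submodule.span_le]
    rintro _ ⟨α, rfl⟩
    exact Submodule.subset_span ⟨(α, I, c), by simp [parWIdx], by simp⟩
  exact key (Submodule.mem_top (x := p))

lemma ordW_succ_le (k : ℕ) : ordW m n (k + 1) ≤ ordW m n k := by
  rw [ordW, Submodule.span_le]
  rintro _ ⟨I, c, p, hp, rfl⟩
  exact coeffW_mem_ordW c (Ideal.pow_le_pow_right (by omega) hp)

/-- One summand of the bracket of elements of orders `k` and `l` has order `k + l - 1`. -/
lemma smul_coeffW_mem_ordW {k l : ℕ} {I J : Finset (Fin n)} (b c : Fin m ⊕ Fin n)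
    {p q : Laurent m} (hp : p ∈ augIdeal m ^ (k - I.card)) (hq : q ∈ augIdeal m ^ (l - J.card)) :
    epsF I (dSet b J) • coeffW (I ∪ dSet b J) c (p * coeffDeriv b J q) ∈
      ordW m n (k + l - 1) := by
  by_cases hd : Disjoint I (dSet b J)
  swap
  · simp [epsF, hd]
  refine Submodule.smul_mem _ _ ?_
  rcases b with i | j
  · refine coeffW_mem_ordW c ?_
    have := Ideal.mul_mem_mul hp (derivation_mem_pow (deriv i) _ hq)
    rw [← pow_add] at this
    refine Ideal.pow_le_pow_right ?_ this
    rw [Finset.card_union_of_disjoint hd]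
    simp only [dSet]
    omega
  · by_cases hj : j ∈ J
    swap
    · simp [coeffDeriv, hj]
    refine coeffW_mem_ordW c ?_
    simp only [coeffDeriv, hj, if_true, LinearMap.smul_apply, LinearMap.id_apply, mul_smul_comm]
    have := Ideal.mul_mem_mul hp hq
    rw [← pow_add] at this
    refine Submodule.smul_of_tower_mem _ _ (Ideal.pow_le_pow_right ?_ this)
    rw [Finset.card_union_of_disjoint hd]
    have := Finset.card_pos.2 ⟨j, hj⟩
    simp only [dSet, Finset.card_erase_of_mem hj]
    omega

lemma bracketW_coeffW_mem_ordW {k l : ℕ} {I J : Finset (Fin n)} (b c : Fin m ⊕ Fin n)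
    {p q : Laurent m} (hp : p ∈ augIdeal m ^ (k - I.card)) (hq : q ∈ augIdeal m ^ (l - J.card)) :
    bracketW m n (coeffW I b p) (coeffW J c q) ∈ ordW m n (k + l - 1) := by
  rw [bracketW_coeffW]
  refine sub_mem (smul_coeffW_mem_ordW b c hp hq) (Submodule.smul_mem _ _ ?_)
  rw [add_comm k l]
  exact smul_coeffW_mem_ordW c b hq hp

lemma bracketW_coeffW_inl (i : Fin m) (c : Fin m ⊕ Fin n) (J : Finset (Fin n))
    (p q : Laurent m) :
    bracketW m n (coeffW ∅ (Sum.inl i) p) (coeffW J c q) =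
      coeffW J c (p * deriv i q) - coeffW J (Sum.inl i) (q * coeffDeriv c ∅ p) := by
  have h : dSet c (∅ : Finset (Fin n)) = ∅ := by rcases c with l | j <;> simp [dSet]
  rw [bracketW_coeffW, h]
  simp [parWIdx, dSet, coeffDeriv]

lemma coeffW_singleton_mem_Wpar (j : Fin n) :
    coeffW {j} (Sum.inr j) (1 : Laurent m) ∈ Wpar m n 0 := by
  rw [← mono_zero]
  exact Submodule.subset_span ⟨(0, {j}, Sum.inr j), by simp [parWIdx], by simp⟩

lemma bracketW_coeffW_inr (j : Fin n) (c : Fin m ⊕ Fin n) (I : Finset (Fin n)) (p : Laurent m) :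
    bracketW m n (coeffW {j} (Sum.inr j) 1) (coeffW I c p) =
      (if j ∈ I then coeffW I c p else 0) - if c = Sum.inr j then coeffW I c p else 0 := by
  have hpar : parWIdx ((0 : Fin m → ℤ), {j}, (Sum.inr j : Fin m ⊕ Fin n)) = 2 := by
    simp [parWIdx]
  rw [bracketW_coeffW, hpar, pow_mul]
  congr 1
  · by_cases hj : j ∈ I
    · have hd : Disjoint {j} (I.erase j) := by simp
      have hsq : ((-1 : ℂ) ^ (I.filter (· < j)).card) * (-1) ^ (I.filter (· < j)).card = 1 := by
        rw [← mul_pow]; simp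
      have hu : {j} ∪ I.erase j = I := by rw [← Finset.insert_eq, Finset.insert_erase hj]
      simp only [dSet, coeffDeriv, hj, if_true, epsF, hd, tauF_singleton_erase, hu,
        LinearMap.smul_apply, LinearMap.id_apply, one_mul, map_smul, smul_smul, hsq, one_smul]
    · simp [coeffDeriv, hj]
  · rcases c with i | l
    · simp [coeffDeriv]
    · by_cases hl : l = j
      · subst hl
        simp [coeffDeriv, dSet, Finset.filter_singleton]
      · simp [coeffDeriv, hl]

/-- The Euler vector field `∑ (t_i - 1) ∂/∂t_i + ∑ ξ_j ∂/∂ξ_j`. -/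
noncomputable def eulerW (m n : ℕ) : WSp m n :=
  ∑ i, coeffW ∅ (Sum.inl i) (S i * Tinv i) + ∑ j, coeffW {j} (Sum.inr j) 1

/-- The vector field `(t_i - 1)^k ∂/∂t_i`. -/
noncomputable def powVec (n : ℕ) (i : Fin m) (k : ℕ) : WSp m n :=
  coeffW ∅ (Sum.inl i) (S i ^ k * Tinv i)

lemma S_pow_mul_mem {i : Fin m} {k : ℕ} (hk : 1 ≤ k) (b : Laurent m) :
    S i ^ k * b ∈ augIdeal m :=
  Ideal.mul_mem_right _ _ (Ideal.pow_mem_of_mem _ (S_mem i) k hk)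

lemma mem_pow_one_sub {p : Laurent m} (hp : p ∈ augIdeal m) (d : ℕ) :
    p ∈ augIdeal m ^ (1 - d) :=
  Ideal.pow_le_pow_right (Nat.sub_le 1 d) (by simpa using hp)

lemma powVec_mem_ordW (i : Fin m) {k : ℕ} (hk : 1 ≤ k) : powVec n i k ∈ ordW m n 1 :=
  coeffW_mem_ordW _ (mem_pow_one_sub (S_pow_mul_mem hk _) _)

lemma powVec_mem_Wpar (i : Fin m) (k : ℕ) : powVec n i k ∈ Wpar m n 0 :=
  coeffW_mem_Wpar ∅ (Sum.inl i) _

lemma eulerW_mem_ordW : eulerW m n ∈ ordW m n 1 := by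
  refine add_mem (sum_mem fun i _ => ?_) (sum_mem fun j _ => ?_)
  · simpa [powVec] using powVec_mem_ordW (n := n) i le_rfl
  · exact coeffW_mem_ordW _ (by simp)

lemma eulerW_mem_Wpar : eulerW m n ∈ Wpar m n 0 := by
  refine add_mem (sum_mem fun i _ => ?_) (sum_mem fun j _ => coeffW_singleton_mem_Wpar j)
  simpa [powVec] using powVec_mem_Wpar (n := n) i 1

/-- The coefficient with which the Euler vector field lowers the derivation part `c`. -/
noncomputable def eulerShift : Fin m ⊕ Fin n → Laurent m
  | Sum.inl i => Tinv i
  | Sum.inr _ => 1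

lemma one_sub_eulerShift_mem (c : Fin m ⊕ Fin n) : 1 - eulerShift c ∈ augIdeal m := by
  rcases c with i | j
  · rw [← neg_mem_iff, neg_sub]
    exact mono_sub_one_mem _
  · simp [eulerShift]

lemma deriv_S_mul_Tinv (i : Fin m) : deriv i (S i * Tinv i) = Tinv i := by
  rw [Derivation.leibniz, deriv_S_self, deriv_Tinv_self, smul_eq_mul, smul_eq_mul, T_eq]
  ring

lemma deriv_S_pow_mul_Tinv_of_ne {i l : Fin m} (h : l ≠ i) (k : ℕ) :
    deriv l (S i ^ k * Tinv i) = 0 := by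
  simp [Derivation.leibniz, Derivation.leibniz_pow, deriv_S_of_ne h, deriv_Tinv_of_ne h]

lemma sum_coeffW_coeffDeriv (c : Fin m ⊕ Fin n) (I : Finset (Fin n)) (p : Laurent m) :
    (∑ i, coeffW I (Sum.inl i) (p * coeffDeriv c ∅ (S i * Tinv i))) +
      (∑ j, if c = Sum.inr j then coeffW I c p else 0) = coeffW I c (eulerShift c * p) := by
  rcases c with l | j
  · rw [Finset.sum_eq_single l]
    · simp only [coeffDeriv, Derivation.coeFn_coe, deriv_S_mul_Tinv, eulerShift]
      simp [mul_comm]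
    · intro i _ hi
      have := deriv_S_pow_mul_Tinv_of_ne (Ne.symm hi) 1
      rw [pow_one] at this
      simp [coeffDeriv, this]
    · simp
  · simp [coeffDeriv, eulerShift]

lemma bracketW_eulerW (c : Fin m ⊕ Fin n) (I : Finset (Fin n)) (p : Laurent m) :
    bracketW m n (eulerW m n) (coeffW I c p) =
      coeffW I c (euler m p + (I.card : ℂ) • p - eulerShift c * p) := by
  have h₁ : ∑ j : Fin n, (if j ∈ I then coeffW I c p else 0) = (I.card : ℂ) • coeffW I c p := by
    simp [Nat.cast_smul_eq_nsmul]
  rw [eulerW, map_add, map_sum, map_sum, LinearMap.add_apply, LinearMap.sum_apply,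
    LinearMap.sum_apply]
  simp only [bracketW_coeffW_inl, bracketW_coeffW_inr, Finset.sum_sub_distrib]
  rw [h₁, ← map_sum, ← euler_apply, map_sub, map_add, map_smul, ← sum_coeffW_coeffDeriv]
  abel

lemma bracketW_eulerW_sub_mem (c : Fin m ⊕ Fin n) {I : Finset (Fin n)} {k : ℕ} {p : Laurent m}
    (hp : p ∈ augIdeal m ^ (k - I.card)) :
    bracketW m n (eulerW m n) (coeffW I c p) - ((k : ℂ) - 1) • coeffW I c p ∈
      ordW m n (k + 1) := by
  rw [bracketW_eulerW, ← map_smul, ← map_sub]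
  refine coeffW_mem_ordW c ?_
  rcases Nat.lt_or_ge k I.card with hk | hk
  · simp [Nat.sub_eq_zero_of_le hk]
  · have hc : ((k - I.card : ℕ) : ℂ) = k - I.card := by push_cast [hk]; ring
    have : euler m p + (I.card : ℂ) • p - eulerShift c * p - ((k : ℂ) - 1) • p =
        (euler m p - ((k - I.card : ℕ) : ℂ) • p) + (1 - eulerShift c) * p := by
      rw [hc]; simp only [sub_smul, sub_mul, one_smul, one_mul]; abel
    rw [this, Nat.sub_add_comm hk]
    refine add_mem (euler_sub_smul_mem_pow _ hp) ?_
    rw [pow_succ']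
    exact Ideal.mul_mem_mul (one_sub_eulerShift_mem c) hp

lemma deriv_S_pow_mul_Tinv (i : Fin m) (k : ℕ) :
    deriv i (S i ^ (k + 1) * Tinv i) = (k + 1) * S i ^ k - S i ^ (k + 1) * Tinv i := by
  rw [Derivation.leibniz, Derivation.leibniz_pow, deriv_S_self, deriv_Tinv_self]
  simp only [smul_eq_mul, nsmul_eq_mul, Nat.add_sub_cancel]
  push_cast
  linear_combination ((k : Laurent m) + 1) * S i ^ k * T_mul_Tinv i

lemma bracketW_powVec_one (i : Fin m) (k : ℕ) :
    bracketW m n (powVec n i 1) (powVec n i (k + 1)) = (k : ℂ) • powVec n i (k + 1) := by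
  have h : powVec n i 1 = coeffW ∅ (Sum.inl i) (S i * Tinv i) := by rw [powVec, pow_one]
  rw [h]
  simp only [powVec, bracketW_coeffW_inl, coeffDeriv, Derivation.coeFn_coe,
    deriv_S_pow_mul_Tinv, deriv_S_mul_Tinv, ← map_sub, ← map_smul]
  congr 1
  rw [Algebra.smul_def, map_natCast]
  have hT := T_mul_Tinv i
  rw [T_eq] at hT
  linear_combination -(S i ^ (k + 1) * Tinv i) * hT

lemma exists_bracketW_powVec_sub (i : Fin m) (k : ℕ) (J : Finset (Fin n)) (c : Fin m ⊕ Fin n)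
    (b : Laurent m) : ∃ r : ℂ, r ≠ 0 ∧
      bracketW m n (powVec n i (k + 1)) (coeffW J c (S i ^ 2 * b)) -
        bracketW m n (powVec n i (k + 2)) (coeffW J c (S i ^ 1 * b)) =
      r • coeffW J c (S i ^ (k + 2) * b) := by
  have h1 : deriv i (S i * b) = T i * b + S i * deriv i b := by
    rw [Derivation.leibniz, deriv_S_self, smul_eq_mul, smul_eq_mul]; ring
  have h2 : deriv i (S i ^ 2 * b) = 2 * S i * T i * b + S i ^ 2 * deriv i b := by
    rw [pow_two, mul_assoc, Derivation.leibniz, h1, deriv_S_self, smul_eq_mul, smul_eq_mul]; ring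
  have hT := T_mul_Tinv i
  by_cases hc : c = Sum.inl i
  · subst hc
    refine ⟨2, two_ne_zero, ?_⟩
    simp only [powVec, bracketW_coeffW_inl, coeffDeriv, Derivation.coeFn_coe,
      deriv_S_pow_mul_Tinv, ← map_sub, ← map_smul, pow_one, h1, h2]
    congr 1
    rw [Algebra.smul_def, map_ofNat]
    push_cast
    linear_combination (S i ^ (k + 2) * b) * hT
  · refine ⟨1, one_ne_zero, ?_⟩
    have h0 (l : ℕ) : coeffDeriv c (∅ : Finset (Fin n)) (S i ^ l * Tinv i) = 0 := by
      rcases c with l' | j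
      · exact deriv_S_pow_mul_Tinv_of_ne (fun h => hc (by rw [h])) l
      · simp [coeffDeriv]
    simp only [powVec, bracketW_coeffW_inl, h0, mul_zero, map_zero, sub_zero, pow_one, h1, h2,
      one_smul, ← map_sub]
    congr 1
    linear_combination (S i ^ (k + 2) * b) * hT

end Coordinates

/-! ### Linear algebra -/

lemma eventually_eq_zero_of_commutator_eq {V : Type*} [AddCommGroup V] [Module ℂ V]
    [FiniteDimensional ℂ V] (e : Module.End ℂ V) (x : ℕ → Module.End ℂ V)
    (h : ∀ k, e * x k - x k * e = (k : ℂ) • x k) : ∀ᶠ k in Filter.atTop, x k = 0 := by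
  let f : Module.End ℂ (Module.End ℂ V) := LinearMap.mulLeft ℂ e - LinearMap.mulRight ℂ e
  have hfin : {k : ℕ | f.HasEigenvalue (k : ℂ)}.Finite :=
    (Module.End.finite_hasEigenvalue f).preimage Nat.cast_injective.injOn
  rw [← Nat.cofinite_eq_atTop]
  refine hfin.subset fun k hk => ?_
  exact Module.End.hasEigenvalue_of_hasEigenvector (x := x k)
    ⟨Module.End.mem_eigenspace_iff.2 (by simpa [f] using h k), hk⟩

lemma exists_eigenvector_top {V : Type*} [AddCommGroup V] [Module ℂ V]
    [FiniteDimensional ℂ V] [Nontrivial V] (e : Module.End ℂ V) :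
    ∃ (r : ℂ) (v : V), v ≠ 0 ∧ e v = r • v ∧
      ∀ (k : ℕ) (w : V), e w = (r + (k + 1 : ℂ)) • w → w = 0 := by
  obtain ⟨r₀, hr₀⟩ := Module.End.exists_eigenvalue e
  obtain ⟨r, hr, hmax⟩ := Set.exists_max_image _ Complex.re
    (Module.End.finite_hasEigenvalue e) ⟨r₀, hr₀⟩
  obtain ⟨v, hv⟩ := Module.End.HasEigenvalue.exists_hasEigenvector hr
  refine ⟨r, v, hv.2, hv.apply_eq_smul, fun k w hw => ?_⟩
  by_contra hne
  have := hmax _ (Module.End.hasEigenvalue_of_hasEigenvector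
    ⟨Module.End.mem_eigenspace_iff.2 hw, hne⟩)
  simp at this
  have : (0 : ℝ) ≤ k := k.cast_nonneg
  linarith

/-! ### Representations -/

section Representation

open Laurent

variable {m n : ℕ} {V : Type*} [AddCommGroup V] [Module ℂ V] [FiniteDimensional ℂ V]

/-- A finite-dimensional representation vanishes on vector fields of large order. -/
lemma exists_map_ordW_eq_zero (ρ : WSp m n →ₗ[ℂ] Module.End ℂ V)
    (hρ : ∀ x ∈ ordW m n 1, x ∈ Wpar m n 0 → ∀ (J : Finset (Fin n)) (c : Fin m ⊕ Fin n)
      (q : Laurent m), q ∈ augIdeal m ^ (1 - J.card) →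
      ρ (bracketW m n x (coeffW J c q)) = ρ x * ρ (coeffW J c q) - ρ (coeffW J c q) * ρ x) :
    ∃ N, ∀ x ∈ ordW m n N, ρ x = 0 := by
  have hvec : ∀ᶠ k in Filter.atTop, ∀ i : Fin m, ρ (powVec n i (k + 1)) = 0 := by
    rw [Filter.eventually_all]
    intro i
    refine eventually_eq_zero_of_commutator_eq (ρ (powVec n i 1)) _ fun k => ?_
    rw [← map_smul, ← bracketW_powVec_one]
    exact (hρ _ (powVec_mem_ordW i le_rfl) (powVec_mem_Wpar i 1) ∅ (Sum.inl i) _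
      (mem_pow_one_sub (S_pow_mul_mem (Nat.le_add_left 1 k) _) _)).symm
  obtain ⟨k, hk⟩ := Filter.eventually_atTop.1 hvec
  have hkill (i : Fin m) (J : Finset (Fin n)) (c : Fin m ⊕ Fin n) (b : Laurent m) :
      ρ (coeffW J c (S i ^ (k + 2) * b)) = 0 := by
    obtain ⟨r, hr, h⟩ := exists_bracketW_powVec_sub i k J c b
    have h' := congrArg ρ h
    rw [map_sub, map_smul,
      hρ _ (powVec_mem_ordW i (Nat.le_add_left 1 k)) (powVec_mem_Wpar i _) J c _
        (mem_pow_one_sub (S_pow_mul_mem one_le_two _) _),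
      hρ _ (powVec_mem_ordW i (Nat.le_add_left 1 (k + 1))) (powVec_mem_Wpar i _) J c _
        (mem_pow_one_sub (S_pow_mul_mem le_rfl _) _), hk k le_rfl i, hk (k + 1) (by omega) i] at h'
    simpa [hr] using h'.symm
  obtain ⟨N, hN⟩ := exists_pow_augIdeal_le (m := m) (k + 2)
  refine ⟨N + n, fun x hx => ?_⟩
  have key : ordW m n (N + n) ≤ LinearMap.ker ρ := by
    rw [ordW, Submodule.span_le]
    rintro _ ⟨I, c, p, hp, rfl⟩
    have hI : I.card ≤ n := by simpa using Finset.card_le_univ I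
    have hp' := hN (Ideal.pow_le_pow_right (by omega : N ≤ N + n - I.card) hp)
    rw [SetLike.mem_coe, LinearMap.mem_ker]
    rw [Ideal.mem_span_range_iff_exists_fun] at hp'
    obtain ⟨b, rfl⟩ := hp'
    simp [mul_comm (b _), hkill]
  exact key hx

/-- The top eigenvector of the Euler vector field is annihilated by fields of order two. -/
lemma exists_ordW_two_annihilates [Nontrivial V] (ρ : WSp m n →ₗ[ℂ] Module.End ℂ V)
    (hρ : ∀ x ∈ ordW m n 1, x ∈ Wpar m n 0 → ∀ (J : Finset (Fin n)) (c : Fin m ⊕ Fin n)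
      (q : Laurent m), q ∈ augIdeal m ^ (1 - J.card) →
      ρ (bracketW m n x (coeffW J c q)) = ρ x * ρ (coeffW J c q) - ρ (coeffW J c q) * ρ x) :
    ∃ v : V, v ≠ 0 ∧ ∀ x ∈ ordW m n 2, ρ x v = 0 := by
  obtain ⟨N, hN⟩ := exists_map_ordW_eq_zero ρ hρ
  obtain ⟨r, v, hv0, hv, htop⟩ := exists_eigenvector_top (ρ (eulerW m n))
  refine ⟨v, hv0, ?_⟩
  have step (k : ℕ) (h : ∀ x ∈ ordW m n (k + 3), ρ x v = 0) :
      ∀ x ∈ ordW m n (k + 2), ρ x v = 0 := by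
    have key : ordW m n (k + 2) ≤ LinearMap.ker ((LinearMap.applyₗ v).comp ρ) := by
      rw [ordW, Submodule.span_le]
      rintro _ ⟨I, c, p, hp, rfl⟩
      have h₁ := h _ (bracketW_eulerW_sub_mem c hp)
      rw [map_sub, map_smul, hρ _ eulerW_mem_ordW eulerW_mem_Wpar I c p
        (Ideal.pow_le_pow_right (by omega) hp)] at h₁
      simp only [LinearMap.sub_apply, Module.End.mul_apply, LinearMap.smul_apply, hv, map_smul,
        sub_eq_zero] at h₁
      refine htop k _ ?_
      change ρ (eulerW m n) (ρ (coeffW I c p) v) = (r + (k + 1 : ℂ)) • ρ (coeffW I c p) v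
      rw [sub_eq_iff_eq_add.1 h₁, ← add_smul]
      congr 1
      push_cast
      ring
    exact fun x hx => key hx
  have all (d : ℕ) : ∀ k, N ≤ k + 2 + d → ∀ x ∈ ordW m n (k + 2), ρ x v = 0 := by
    induction d with
    | zero =>
      intro k hk x hx
      have hanti : Antitone (ordW m n) := antitone_nat_of_succ_le ordW_succ_le
      rw [hN x (hanti hk hx), LinearMap.zero_apply]
    | succ d ih => exact fun k hk => step k (ih (k + 1) (by omega))
  exact all N 0 (by omega)

end Representation

/-- Let `V` be a finite-dimensional simple module over the Lie superalgebra `𝔪Δ`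
(superderivations of `A_{m,n}` with coefficients in the maximal ideal `𝔪`), given by a
nonzero `ℤ₂`-graded space with a parity-compatible action `ρ` of `𝔪Δ` sending
superbrackets to supercommutators, admitting no nontrivial graded invariant subspace.
Then `𝔪²Δ · V = 0`, so `V` factors through `𝔪Δ/𝔪²Δ ≅ 𝔤𝔩(m,n)`. -/
theorem stmt11 (m n : ℕ) (V : Type*) [AddCommGroup V] [Module ℂ V]
    [FiniteDimensional ℂ V] [Nontrivial V]
    (gV : ZMod 2 → Submodule ℂ V) (hcompl : IsCompl (gV 0) (gV 1))
    (ρ : WSp m n →ₗ[ℂ] Module.End ℂ V)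
    (hcl : ∀ x ∈ mPowD m n 1, ∀ y ∈ mPowD m n 1, bracketW m n x y ∈ mPowD m n 1)
    (hpar : ∀ (p : ℕ) (x : WSp m n), x ∈ mPowD m n 1 → x ∈ Wpar m n p →
      ∀ q : ZMod 2, ∀ v ∈ gV q, ρ x v ∈ gV (q + (p : ZMod 2)))
    (hrep : ∀ (p q : ℕ) (x y : WSp m n), x ∈ mPowD m n 1 → y ∈ mPowD m n 1 →
      x ∈ Wpar m n p → y ∈ Wpar m n q →
      ρ (bracketW m n x y) = ρ x * ρ y - ((-1 : ℂ) ^ (p * q)) • (ρ y * ρ x))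
    (hsimp : ∀ P : Submodule ℂ V, P = (P ⊓ gV 0) ⊔ (P ⊓ gV 1) →
      (∀ x ∈ mPowD m n 1, ∀ v ∈ P, ρ x v ∈ P) → P = ⊥ ∨ P = ⊤) :
    ∀ x ∈ mPowD m n 2, ρ x = 0 := by
  have hmem (I : Finset (Fin n)) (c : Fin m ⊕ Fin n) {k : ℕ} (hk : 1 ≤ k) (p : Laurent m)
      (hp : p ∈ Laurent.augIdeal m ^ (k - I.card)) : coeffW I c p ∈ mPowD m n 1 :=
    ordW_one_le (coeffW_mem_ordW c (Ideal.pow_le_pow_right (by omega) hp))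
  obtain ⟨v, hv0, hv⟩ := exists_ordW_two_annihilates ρ fun x hx hx0 J c q hq => by
    simpa using hrep 0 _ x _ (ordW_one_le hx) (hmem J c le_rfl q hq) hx0 (coeffW_mem_Wpar J c q)
  let P : Submodule ℂ V :=
    { carrier := {v | ∀ x ∈ ordW m n 2, ρ x v = 0}
      zero_mem' := by simp
      add_mem' := fun {a b} ha hb x hx => by rw [map_add, ha x hx, hb x hx, add_zero]
      smul_mem' := fun r a ha x hx => by rw [map_smul, ha x hx, smul_zero] }
  have hP {v : V} (h : ∀ (I : Finset (Fin n)) (c : Fin m ⊕ Fin n) (p : Laurent m),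
      p ∈ Laurent.augIdeal m ^ (2 - I.card) → ρ (coeffW I c p) v = 0) : v ∈ P := by
    have key : ordW m n 2 ≤ LinearMap.ker ((LinearMap.applyₗ v).comp ρ) := by
      rw [ordW, Submodule.span_le]
      rintro _ ⟨I, c, p, hp, rfl⟩
      exact h I c p hp
    exact fun x hx => key hx
  have hgraded : P = (P ⊓ gV 0) ⊔ (P ⊓ gV 1) := by
    refine le_antisymm (fun v hv => ?_) (sup_le inf_le_left inf_le_left)
    obtain ⟨v₀, h₀, v₁, h₁, rfl⟩ := Submodule.mem_sup.1
      (hcompl.sup_eq_top ▸ Submodule.mem_top : v ∈ gV 0 ⊔ gV 1)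
    have hz (I : Finset (Fin n)) (c : Fin m ⊕ Fin n) (p : Laurent m)
        (hp : p ∈ Laurent.augIdeal m ^ (2 - I.card)) :
        ρ (coeffW I c p) v₀ = 0 ∧ ρ (coeffW I c p) v₁ = 0 := by
      have hsum : ρ (coeffW I c p) v₀ + ρ (coeffW I c p) v₁ = 0 := by
        rw [← map_add]
        exact hv _ (coeffW_mem_ordW c hp)
      have e₀ := hpar _ _ (hmem I c one_le_two p hp) (coeffW_mem_Wpar I c p) 0 v₀ h₀
      have e₁ := hpar _ _ (hmem I c one_le_two p hp) (coeffW_mem_Wpar I c p) 1 v₁ h₁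
      have hdisj (q : ZMod 2) : Disjoint (gV (0 + q)) (gV (1 + q)) := by
        fin_cases q
        · exact hcompl.disjoint
        · exact hcompl.disjoint.symm
      have hzero : ρ (coeffW I c p) v₀ = 0 := by
        refine Submodule.disjoint_def.1 (hdisj _) _ e₀ ?_
        rw [eq_neg_of_add_eq_zero_left hsum]
        exact neg_mem e₁
      exact ⟨hzero, by simpa [hzero] using hsum⟩
    exact Submodule.add_mem_sup ⟨hP fun I c p hp => (hz I c p hp).1, h₀⟩
      ⟨hP fun I c p hp => (hz I c p hp).2, h₁⟩
  have hinv : ∀ x ∈ mPowD m n 1, ∀ v ∈ P, ρ x v ∈ P := by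
    intro x hx v hv
    have key : ordW m n 1 ≤ P.comap ((LinearMap.applyₗ v).comp ρ) := by
      rw [ordW, Submodule.span_le]
      rintro _ ⟨I, b, p, hp, rfl⟩
      refine hP fun J c q hq => ?_
      have h := hrep _ _ _ _ (hmem J c one_le_two q hq) (hmem I b le_rfl p hp)
        (coeffW_mem_Wpar J c q) (coeffW_mem_Wpar I b p)
      have h' := LinearMap.congr_fun h v
      have hbr := bracketW_coeffW_mem_ordW (k := 2) (l := 1) c b hq hp
      rw [hv _ hbr, LinearMap.sub_apply, LinearMap.smul_apply,
        Module.End.mul_apply, Module.End.mul_apply, hv _ (coeffW_mem_ordW c hq), map_zero,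
        smul_zero, sub_zero] at h'
      exact h'.symm
    exact key (mPowD_le_ordW 1 hx)
  rcases hsimp P hgraded hinv with h | h
  · have : v ∈ P := hv
    rw [h] at this
    exact absurd this hv0
  · intro x hx
    ext w
    have : w ∈ P := h ▸ Submodule.mem_top
    exact this x (mPowD_le_ordW 2 hx)
end

section
/- Let M be a uniformly bounded (cuspidal) weight module over the Witt superalgebra W_{m,n} with m ≥ 1, and suppose M is ℤ^m-graded by weights. If there exists l₀ such that ∑_{i=0}^{l₀} (-1)^i C(l₀,i) t^{α+ie₁} ξ_I ∂ · t^{β−ie₁} d_μ v = 0 for all v ∈ M, all α, β ∈ ℤ^m, all ∂ ∈ Δ, all I ⊆ {1,...,n}, and all μ ∈ ℂ^m, then in the A_{m,n}-cover ĥM = (W ⊗ M)/K(M), every element t^α ξ_I ∂ ⊗ t^β d_μ v + K(M) with α having all coordinates of absolute value sum exceeding m·l₀ lies in ∑_{‖α'‖ ≤ m l₀, I'} t^{α'} ξ_{I'} Δ ⊗ M + K(M), where ‖α‖ = ∑|α_i|. -/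
open TensorProduct

/-- If an ideal stable under a derivation `D` contains `g ^ l` and `D (D g) = 0`, then it
contains `(D g) ^ l`. -/
theorem Derivation.apply_pow_mem {R : Type*} [CommRing R] [Algebra ℂ R] (D : Derivation ℂ R R)
    (J : Ideal R) (hJ : ∀ x ∈ J, D x ∈ J) {g : R} (hg : D (D g) = 0) {l : ℕ} (hl : g ^ l ∈ J) :
    D g ^ l ∈ J := by
  have key : ∀ k r : ℕ, k + r = l → D g ^ k * g ^ r ∈ J := by
    intro k
    induction k with
    | zero =>
      intro r hr
      obtain rfl : r = l := by omega
      simpa using hl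
    | succ k ih =>
      intro r hr
      have hD := hJ _ (ih (r + 1) (by omega))
      have hcalc : D (D g ^ k * g ^ (r + 1)) = (r + 1) • (D g ^ (k + 1) * g ^ r) := by
        rw [Derivation.leibniz, Derivation.leibniz_pow, Derivation.leibniz_pow, hg]
        simp only [smul_eq_mul, nsmul_eq_mul, Nat.add_sub_cancel]
        ring
      rw [hcalc, ← Nat.cast_smul_eq_nsmul ℂ] at hD
      have hne : ((r + 1 : ℕ) : ℂ) ≠ 0 := Nat.cast_ne_zero.mpr (Nat.succ_ne_zero r)
      have hinv := J.mul_mem_left (algebraMap ℂ R ((r + 1 : ℕ) : ℂ)⁻¹) hD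
      rwa [← Algebra.smul_def, inv_smul_smul₀ hne] at hinv
  simpa using key l 0 (by omega)

theorem Submodule.mem_of_add_mem_of_mem {R E : Type*} [Ring R] [AddCommMonoid E] [Module R E]
    (S : Submodule R E) {x y : E} (h : x + y ∈ S) (hx : x ∈ S) : y ∈ S := by
  have hy : (-1 : R) • x + (x + y) = y := by
    nth_rw 2 [← one_smul R x]
    rw [← add_assoc, ← add_smul, neg_add_cancel, zero_smul, zero_add]
  exact hy ▸ S.add_mem (S.smul_mem _ hx) h

namespace LaurentPair

/-- Laurent polynomials in two groups of variables `t₁,…,t_m` and `s₁,…,s_m`. -/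
abbrev Ring (m : ℕ) := AddMonoidAlgebra ℂ ((Fin m → ℤ) × (Fin m → ℤ))

variable {m n : ℕ}

/-- The monomial `t^α s^β`. -/
noncomputable def mono (α β : Fin m → ℤ) : Ring m := AddMonoidAlgebra.single (α, β) 1

theorem mono_mul_mono (α β γ δ : Fin m → ℤ) :
    mono α β * mono γ δ = mono (α + γ) (β + δ) := by
  simp [mono, AddMonoidAlgebra.single_mul_single]

theorem mono_pow (α β : Fin m → ℤ) (k : ℕ) : mono α β ^ k = mono (k • α) (k • β) := by
  simp [mono, AddMonoidAlgebra.single_pow]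

theorem linearMap_ext {E : Type*} [AddCommMonoid E] [Module ℂ E] {f g : Ring m →ₗ[ℂ] E}
    (h : ∀ α β, f (mono α β) = g (mono α β)) : f = g :=
  (AddMonoidAlgebra.basis ((Fin m → ℤ) × (Fin m → ℤ)) ℂ).ext fun p => by
    simpa [mono] using h p.1 p.2

/-- The linear map on `Ring m` with prescribed values on monomials. -/
noncomputable def lift {E : Type*} [AddCommMonoid E] [Module ℂ E]
    (f : (Fin m → ℤ) → (Fin m → ℤ) → E) : Ring m →ₗ[ℂ] E :=
  (AddMonoidAlgebra.basis ((Fin m → ℤ) × (Fin m → ℤ)) ℂ).constr ℂ fun p => f p.1 p.2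

@[simp]
theorem lift_mono {E : Type*} [AddCommMonoid E] [Module ℂ E]
    (f : (Fin m → ℤ) → (Fin m → ℤ) → E) (α β : Fin m → ℤ) : lift f (mono α β) = f α β := by
  have h := (AddMonoidAlgebra.basis ((Fin m → ℤ) × (Fin m → ℤ)) ℂ).constr_basis ℂ
    (fun p => f p.1 p.2) (α, β)
  rwa [AddMonoidAlgebra.basis_apply] at h

/-- The diagonal action of the vector field `t^e d_a`, as a linear map. -/
noncomputable def diagLin (a : Fin m) (e : Fin m → ℤ) : Ring m →ₗ[ℂ] Ring m :=
  lift fun α β => (α a : ℂ) • mono (α + e) β + (β a : ℂ) • mono α (β + e)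

theorem diagLin_leibniz (a : Fin m) (e : Fin m → ℤ) (x y : Ring m) :
    diagLin a e (x * y) = x • diagLin a e y + y • diagLin a e x := by
  have h : (LinearMap.mul ℂ (Ring m)).compr₂ (diagLin a e) =
      (LinearMap.mul ℂ (Ring m)).compl₂ (diagLin a e) +
        ((LinearMap.mul ℂ (Ring m)).compl₂ (diagLin a e)).flip := by
    refine linearMap_ext fun α β => linearMap_ext fun γ δ => ?_
    simp only [LinearMap.compr₂_apply, LinearMap.mul_apply', LinearMap.add_apply,
      LinearMap.compl₂_apply, LinearMap.flip_apply, mono_mul_mono, diagLin, lift_mono, mul_add,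
      mul_smul_comm]
    rw [show γ + (α + e) = α + γ + e by abel, show α + (γ + e) = α + γ + e by abel,
      show δ + (β + e) = β + δ + e by abel, show β + (δ + e) = β + δ + e by abel,
      add_comm γ α, add_comm δ β]
    simp only [Pi.add_apply, Int.cast_add]
    module
  simpa using LinearMap.congr_fun₂ h x y

/-- The diagonal action of the vector field `t^e d_a`, as a derivation. -/
noncomputable def diag (a : Fin m) (e : Fin m → ℤ) : Derivation ℂ (Ring m) (Ring m) :=
  Derivation.mk' (diagLin a e) (diagLin_leibniz a e)

theorem diag_mono (a : Fin m) (e α β : Fin m → ℤ) :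
    diag a e (mono α β) = (α a : ℂ) • mono (α + e) β + (β a : ℂ) • mono α (β + e) := by
  simp [diag, diagLin]

/-- The difference `s_k - t_k`. -/
noncomputable def diff (k : Fin m) : Ring m := mono 0 (Pi.single k 1) - mono (Pi.single k 1) 0

theorem mono_mul_diff_pow (α β : Fin m → ℤ) (k : Fin m) (l : ℕ) :
    mono α β * diff k ^ l = ∑ i ∈ Finset.range (l + 1), ((-1 : ℂ) ^ i * (l.choose i : ℂ)) •
      mono (α + i • Pi.single k 1) (β + (l - i) • Pi.single k 1) := by
  rw [diff, sub_eq_neg_add, add_pow, Finset.mul_sum]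
  refine Finset.sum_congr rfl fun i _ => ?_
  have h : mono (α + i • Pi.single k 1) (β + (l - i) • Pi.single k 1) =
      mono α β * (mono (Pi.single k 1) 0 ^ i * mono 0 (Pi.single k 1) ^ (l - i)) := by
    simp [mono_pow, mono_mul_mono]
  rw [h, neg_pow, Algebra.smul_def]
  simp only [map_mul, map_pow, map_neg, map_one, map_natCast]
  ring

theorem diag_diff {a k : Fin m} :
    diag a (Pi.single k 1 - Pi.single a 1) (diff a) = diff k := by
  simp [diff, diag_mono]

theorem diag_diff_of_ne {a k : Fin m} (h : a ≠ k) (e : Fin m → ℤ) : diag a e (diff k) = 0 := by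
  simp [diff, diag_mono, Pi.single_eq_of_ne h]

variable {V : Type*} [AddCommGroup V] [Module ℂ V]

/-- The operator `t^α s^β ↦ (t^α ξ_I ∂_c) (t^β d_j)` on `V`. -/
noncomputable def toEnd (ρ : WSp m n →ₗ[ℂ] Module.End ℂ V) (I : Finset (Fin n))
    (c : Fin m ⊕ Fin n) (j : Fin m) : Ring m →ₗ[ℂ] Module.End ℂ V :=
  lift fun α β => ρ (Finsupp.single (α, I, c) 1) * ρ (Finsupp.single (β, ∅, Sum.inl j) 1)

/-- The ideal of Laurent polynomials all of whose multiples act by zero. -/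
noncomputable def annIdeal (ρ : WSp m n →ₗ[ℂ] Module.End ℂ V) : Ideal (Ring m) where
  carrier := {F | ∀ (G : Ring m) (I : Finset (Fin n)) (c : Fin m ⊕ Fin n) (j : Fin m),
    toEnd ρ I c j (G * F) = 0}
  add_mem' hx hy G I c j := by rw [mul_add, map_add, hx, hy, add_zero]
  zero_mem' G I c j := by simp
  smul_mem' r x hx G I c j := by
    rw [smul_eq_mul, ← mul_assoc]
    exact hx _ I c j

theorem mem_annIdeal_of_mono {ρ : WSp m n →ₗ[ℂ] Module.End ℂ V} {F : Ring m}
    (h : ∀ α β I c j, toEnd ρ I c j (mono α β * F) = 0) : F ∈ annIdeal ρ := by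
  intro G I c j
  have h0 : toEnd ρ I c j ∘ₗ LinearMap.mulRight ℂ F = 0 :=
    linearMap_ext fun α β => by simpa using h α β I c j
  simpa using LinearMap.congr_fun h0 G

theorem bracketW_vector (a : Fin m) (e α : Fin m → ℤ) (I : Finset (Fin n))
    (c : Fin m ⊕ Fin n) :
    bracketW m n (Finsupp.single (e, ∅, Sum.inl a) 1) (Finsupp.single (α, I, c) 1) =
      (α a : ℂ) • Finsupp.single (α + e, I, c) 1 -
        dCoeff c e ∅ • Finsupp.single (α + e, I, Sum.inl a) 1 := by
  have hset : dSet c (∅ : Finset (Fin n)) = ∅ := by cases c <;> simp [dSet]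
  have hleft : attachD c (derMono (e, ∅, Sum.inl a) (α, I)) =
      (α a : ℂ) • Finsupp.single (α + e, I, c) 1 := by
    simp only [derMono, mulMono, attachD, map_smul, Finsupp.lmapDomain_apply,
      Finsupp.mapDomain_single]
    simp [dCoeff, dSet, epsF, tauF, add_comm e α]
  have hright : attachD (Sum.inl a) (derMono (α, I, c) (e, ∅)) =
      dCoeff c e ∅ • Finsupp.single (α + e, I, Sum.inl a) 1 := by
    simp only [derMono, mulMono, attachD, map_smul, Finsupp.lmapDomain_apply,
      Finsupp.mapDomain_single, hset]
    simp [epsF, tauF]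
  have hbr : bracketW m n (Finsupp.single (e, ∅, Sum.inl a) 1) (Finsupp.single (α, I, c) 1) =
      bracketMono (e, ∅, Sum.inl a) (α, I, c) := by
    simp [bracketW]
  rw [hbr, bracketMono, hleft, hright]
  simp [parWIdx]

/-- The linear map `ρ` is a representation of the Lie superalgebra `W_{m,n}`. -/
def IsSuperRep (ρ : WSp m n →ₗ[ℂ] Module.End ℂ V) : Prop :=
  ∀ (p q : ℕ) (x y : WSp m n), x ∈ Wpar m n p → y ∈ Wpar m n q →
    ρ (bracketW m n x y) = ρ x * ρ y - ((-1 : ℂ) ^ (p * q)) • (ρ y * ρ x)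

theorem commutator_vector {ρ : WSp m n →ₗ[ℂ] Module.End ℂ V} (hrep : IsSuperRep ρ)
    (a : Fin m) (e α : Fin m → ℤ) (I : Finset (Fin n))
    (c : Fin m ⊕ Fin n) :
    ρ (Finsupp.single (e, ∅, Sum.inl a) 1) * ρ (Finsupp.single (α, I, c) 1) =
      ρ (Finsupp.single (α, I, c) 1) * ρ (Finsupp.single (e, ∅, Sum.inl a) 1) +
      ((α a : ℂ) • ρ (Finsupp.single (α + e, I, c) 1) -
        dCoeff c e ∅ • ρ (Finsupp.single (α + e, I, Sum.inl a) 1)) := by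
  have h := hrep 0 (parWIdx ((α, I, c) : WIdx m n)) (Finsupp.single (e, ∅, Sum.inl a) 1)
    (Finsupp.single (α, I, c) 1) (Submodule.subset_span ⟨_, by simp [parWIdx], rfl⟩)
    (Submodule.subset_span ⟨_, rfl, rfl⟩)
  rw [bracketW_vector, map_sub, map_smul, map_smul, zero_mul, pow_zero, one_smul] at h
  rw [h]
  abel

theorem toEnd_diag {ρ : WSp m n →ₗ[ℂ] Module.End ℂ V} (hrep : IsSuperRep ρ)
    (a : Fin m) (e : Fin m → ℤ) (I : Finset (Fin n)) (c : Fin m ⊕ Fin n)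
    (j : Fin m) (F : Ring m) :
    toEnd ρ I c j (diag a e F) =
      ρ (Finsupp.single (e, ∅, Sum.inl a) 1) * toEnd ρ I c j F -
        toEnd ρ I c j F * ρ (Finsupp.single (e, ∅, Sum.inl a) 1) +
      dCoeff c e ∅ • toEnd ρ I (Sum.inl a) j (mono e 0 * F) +
      (e j : ℂ) • toEnd ρ I c a (mono 0 e * F) := by
  have h : toEnd ρ I c j ∘ₗ (diag a e : Ring m →ₗ[ℂ] Ring m) =
      (LinearMap.mulLeft ℂ (ρ (Finsupp.single (e, ∅, Sum.inl a) 1)) -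
        LinearMap.mulRight ℂ (ρ (Finsupp.single (e, ∅, Sum.inl a) 1))) ∘ₗ toEnd ρ I c j +
      dCoeff c e ∅ • toEnd ρ I (Sum.inl a) j ∘ₗ LinearMap.mulLeft ℂ (mono e 0) +
      (e j : ℂ) • toEnd ρ I c a ∘ₗ LinearMap.mulLeft ℂ (mono 0 e) := by
    refine linearMap_ext fun α β => ?_
    simp only [LinearMap.comp_apply, LinearMap.add_apply, LinearMap.sub_apply,
      LinearMap.smul_apply, LinearMap.mulLeft_apply, LinearMap.mulRight_apply,
      Derivation.coeFn_coe, diag_mono, mono_mul_mono, map_add, map_smul, toEnd, lift_mono,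
      zero_add]
    have hx := commutator_vector hrep a e α I c
    have hy := commutator_vector hrep a e β ∅ (Sum.inl j)
    rw [← mul_assoc, hx, mul_assoc _ _ (ρ (Finsupp.single (e, ∅, Sum.inl a) 1)), add_mul,
      mul_assoc _ (ρ (Finsupp.single (e, ∅, Sum.inl a) 1)), hy]
    simp only [dCoeff, add_comm e, mul_add, sub_mul, mul_sub, smul_mul_assoc, mul_smul_comm]
    abel
  simpa [LinearMap.sub_apply] using LinearMap.congr_fun h F

theorem diag_mem_annIdeal {ρ : WSp m n →ₗ[ℂ] Module.End ℂ V} (hrep : IsSuperRep ρ)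
    (a : Fin m) (e : Fin m → ℤ) {F : Ring m} (hF : F ∈ annIdeal ρ) :
    diag a e F ∈ annIdeal ρ := by
  intro G I c j
  have hG : G * diag a e F = diag a e (G * F) - diag a e G * F := by
    rw [Derivation.leibniz, smul_eq_mul, smul_eq_mul]
    ring
  rw [hG, map_sub, hF, sub_zero, toEnd_diag hrep, hF]
  simp [← mul_assoc, hF _ _ _ _]

theorem diff_pow_mem_annIdeal {ρ : WSp m n →ₗ[ℂ] Module.End ℂ V} (hrep : IsSuperRep ρ)
    {a : Fin m} {l : ℕ} (ha : diff a ^ l ∈ annIdeal ρ) (k : Fin m) :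
    diff k ^ l ∈ annIdeal ρ := by
  rcases eq_or_ne a k with rfl | hne
  · exact ha
  · have h := (diag a (Pi.single k 1 - Pi.single a 1)).apply_pow_mem (annIdeal ρ)
      (fun x hx => diag_mem_annIdeal hrep a _ hx) (g := diff a)
      (by rw [diag_diff, diag_diff_of_ne hne]) ha
    rwa [diag_diff] at h

/-- The map `t^α s^β ↦ t^α ξ_I ∂_c ⊗ (t^β d_j) v` into `W ⊗ V`. -/
noncomputable def toTensor (ρ : WSp m n →ₗ[ℂ] Module.End ℂ V) (I : Finset (Fin n))
    (c : Fin m ⊕ Fin n) (j : Fin m) (v : V) : Ring m →ₗ[ℂ] WSp m n ⊗[ℂ] V :=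
  lift fun α β => Finsupp.single (α, I, c) 1 ⊗ₜ[ℂ] ρ (Finsupp.single (β, ∅, Sum.inl j) 1) v

theorem lift_smulAW_toTensor (ρ : WSp m n →ₗ[ℂ] Module.End ℂ V) (I L : Finset (Fin n))
    (c : Fin m ⊕ Fin n) (j : Fin m) (v : V) (γ : Fin m → ℤ) (F : Ring m) :
    TensorProduct.lift (ρ ∘ₗ smulAW m n (Finsupp.single (γ, L) 1)) (toTensor ρ I c j v F) =
      epsF L I • toEnd ρ (L ∪ I) c j (mono γ 0 * F) v := by
  have h : TensorProduct.lift (ρ ∘ₗ smulAW m n (Finsupp.single (γ, L) 1)) ∘ₗ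
        toTensor ρ I c j v =
      epsF L I • LinearMap.applyₗ v ∘ₗ toEnd ρ (L ∪ I) c j ∘ₗ
        LinearMap.mulLeft ℂ (mono γ 0) := by
    refine linearMap_ext fun α β => ?_
    simp [toTensor, toEnd, mono_mul_mono, smulAW, smulMonoW, -Finsupp.smul_single]
  simpa using LinearMap.congr_fun h F

theorem toTensor_mem_ker {ρ : WSp m n →ₗ[ℂ] Module.End ℂ V} {F : Ring m}
    (hF : F ∈ annIdeal ρ) (I : Finset (Fin n)) (c : Fin m ⊕ Fin n) (j : Fin m) (v : V) :
    toTensor ρ I c j v F ∈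
      ⨅ a : ASp m n, LinearMap.ker (TensorProduct.lift (ρ ∘ₗ smulAW m n a)) := by
  rw [Submodule.mem_iInf]
  intro a
  rw [LinearMap.mem_ker]
  change TensorProduct.uncurry (.id ℂ) (WSp m n) V V (ρ ∘ₗ smulAW m n a) _ = 0
  induction a using Finsupp.induction_linear with
  | zero => simp
  | add f g hf hg => simp only [map_add, LinearMap.comp_add, LinearMap.add_apply, hf, hg, add_zero]
  | single u r =>
    have hu := lift_smulAW_toTensor ρ I u.2 c j v u.1 F
    rw [hF, LinearMap.zero_apply, smul_zero] at hu
    rw [← mul_one r, ← smul_eq_mul, ← Finsupp.smul_single, map_smul, LinearMap.comp_smul,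
      map_smul, LinearMap.smul_apply]
    exact (congrArg (r • ·) hu).trans (smul_zero r)

theorem toTensor_mono_mem {ρ : WSp m n →ₗ[ℂ] Module.End ℂ V} {l : ℕ}
    (hdiff : ∀ k : Fin m, diff k ^ l ∈ annIdeal ρ) {S : Submodule ℂ (WSp m n ⊗[ℂ] V)}
    (hK : (⨅ a : ASp m n, LinearMap.ker (TensorProduct.lift (ρ ∘ₗ smulAW m n a))) ≤ S)
    (I : Finset (Fin n)) (c : Fin m ⊕ Fin n) (j : Fin m) (v : V)
    (hS : ∀ α β : Fin m → ℤ, ∑ i, (α i).natAbs ≤ m * l → toTensor ρ I c j v (mono α β) ∈ S)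
    (α β : Fin m → ℤ) : toTensor ρ I c j v (mono α β) ∈ S := by
  induction hN : ∑ i, (α i).natAbs using Nat.strong_induction_on generalizing α β with
  | _ N ih =>
  by_cases hle : ∑ i, (α i).natAbs ≤ m * l
  · exact hS α β hle
  obtain ⟨k, hk⟩ : ∃ k, l < (α k).natAbs := by
    by_contra! hcon
    exact hle ((Finset.sum_le_sum fun i _ => hcon i).trans (by simp))
  -- all the monomials `t^{α + z e_k}` closer to the origin are already covered
  have hlow : ∀ (z : ℤ) (δ : Fin m → ℤ), (α k + z).natAbs < (α k).natAbs →
      toTensor ρ I c j v (mono (α + z • Pi.single k 1) δ) ∈ S := by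
    intro z δ hz
    refine ih _ ?_ _ _ rfl
    rw [← hN]
    refine Finset.sum_lt_sum (fun i _ => ?_) ⟨k, Finset.mem_univ k, by simpa using hz⟩
    rcases eq_or_ne i k with rfl | hne
    · simpa using hz.le
    · simp [hne]
  have hrel : ∀ γ δ : Fin m → ℤ, ∑ i ∈ Finset.range (l + 1),
      ((-1 : ℂ) ^ i * (l.choose i : ℂ)) •
        toTensor ρ I c j v (mono (γ + i • Pi.single k 1) (δ + (l - i) • Pi.single k 1)) ∈ S := by
    intro γ δ
    have h := hK (toTensor_mem_ker ((annIdeal ρ).mul_mem_left (mono γ δ) (hdiff k)) I c j v)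
    rw [mono_mul_diff_pow, map_sum] at h
    simpa only [map_smul] using h
  rcases le_or_gt (α k) 0 with hneg | hpos
  · have h := hrel α (β - l • Pi.single k 1)
    rw [Finset.sum_range_succ'] at h
    have h0 := S.mem_of_add_mem_of_mem h ?_
    · simpa using h0
    · refine S.sum_mem fun i hi => S.smul_mem _ ?_
      rw [Finset.mem_range] at hi
      have := hlow ((i + 1 : ℕ) : ℤ) (β - l • Pi.single k 1 + (l - (i + 1)) • Pi.single k 1)
        (by omega)
      rwa [natCast_zsmul] at this
  · have h := hrel (α - l • Pi.single k 1) β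
    rw [Finset.sum_range_succ] at h
    have h0 := S.mem_of_add_mem_of_mem h ?_
    · rw [S.smul_mem_iff (by simp)] at h0
      simpa using h0
    · refine S.sum_mem fun i hi => S.smul_mem _ ?_
      rw [Finset.mem_range] at hi
      have := hlow ((i : ℤ) - l) (β + (l - i) • Pi.single k 1) (by omega)
      rwa [sub_zsmul, natCast_zsmul, natCast_zsmul, ← sub_eq_add_neg, add_sub_assoc',
        add_sub_right_comm] at this

end LaurentPair

/-- Let `M` be a uniformly bounded (cuspidal) weight module over the Witt superalgebra
`W_{m,n}` (`m ≥ 1`), graded by its `ℤ^m`-weights `Vwt`.  Suppose there exists `l₀` such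
that `∑_{i=0}^{l₀} (-1)^i C(l₀,i) (t^{α+ie₁} ξ_I ∂) · (t^{β-ie₁} d_μ) v = 0` for all
`v ∈ M`, `α, β ∈ ℤ^m`, `∂ ∈ Δ`, `I ⊆ {1,…,n}` and `μ ∈ ℂ^m`.  Then in the
`A_{m,n}`-cover `(W ⊗ M)/K(M)` every element `t^α ξ_I ∂ ⊗ (t^β d_μ) v + K(M)` with
`‖α‖ = ∑|α_i| > m l₀` lies in
`∑_{‖α'‖ ≤ m l₀} t^{α'} ξ_{I'} Δ ⊗ M + K(M)`, where
`K(M) = {∑ xᵢ ⊗ vᵢ : ∑ (a xᵢ) vᵢ = 0 for all a ∈ A_{m,n}}`. -/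
theorem stmt17 (m n : ℕ) (hm : 0 < m) (V : Type) [AddCommGroup V] [Module ℂ V]
    (ρ : WSp m n →ₗ[ℂ] Module.End ℂ V)
    (hrep : ∀ (p q : ℕ) (x y : WSp m n), x ∈ Wpar m n p → y ∈ Wpar m n q →
      ρ (bracketW m n x y) = ρ x * ρ y - ((-1 : ℂ) ^ (p * q)) • (ρ y * ρ x))
    (Vwt : (Fin m → ℤ) → Submodule ℂ V)
    (hgr : ∀ (γ δ : Fin m → ℤ) (x : WSp m n), x ∈ Wgr m n γ →
      ∀ v ∈ Vwt δ, ρ x v ∈ Vwt (γ + δ))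
    (hsup : (⨆ δ : Fin m → ℤ, Vwt δ) = ⊤)
    (NB : ℕ) (hbound : ∀ δ : Fin m → ℤ, Module.finrank ℂ ↥(Vwt δ) ≤ NB)
    (l₀ : ℕ)
    (hid : ∀ (α β : Fin m → ℤ) (I : Finset (Fin n)) (c : Fin m ⊕ Fin n)
        (μ : Fin m → ℂ) (v : V),
      ∑ i ∈ Finset.range (l₀ + 1),
        ((-1 : ℂ) ^ i * (l₀.choose i : ℂ)) •
          ρ (Finsupp.single (α + i • Pi.single (⟨0, hm⟩ : Fin m) 1, I, c) 1)
            (ρ (∑ j : Fin m, μ j •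
              (Finsupp.single (β - i • Pi.single (⟨0, hm⟩ : Fin m) 1, ∅, Sum.inl j) 1
                : WSp m n)) v) = 0) :
    ∀ (α β : Fin m → ℤ) (I : Finset (Fin n)) (c : Fin m ⊕ Fin n)
      (μ : Fin m → ℂ) (v : V),
      m * l₀ < ∑ i : Fin m, (α i).natAbs →
      ((Finsupp.single (α, I, c) 1 : WSp m n) ⊗ₜ[ℂ]
          (ρ (∑ j : Fin m, μ j •
            (Finsupp.single (β, ∅, Sum.inl j) 1 : WSp m n)) v))
        ∈ (Submodule.span ℂ
            {z : WSp m n ⊗[ℂ] V | ∃ (α' : Fin m → ℤ) (I' : Finset (Fin n))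
                (c' : Fin m ⊕ Fin n) (u : V),
              (∑ i : Fin m, (α' i).natAbs) ≤ m * l₀ ∧
              z = (Finsupp.single (α', I', c') 1 : WSp m n) ⊗ₜ[ℂ] u})
          ⊔ (⨅ a : ASp m n,
              LinearMap.ker (TensorProduct.lift (ρ ∘ₗ smulAW m n a))) := by
  intro α β I c μ v _
  have hzero : LaurentPair.diff ⟨0, hm⟩ ^ l₀ ∈ LaurentPair.annIdeal ρ := by
    refine LaurentPair.mem_annIdeal_of_mono fun α β I c j => ?_
    rw [LaurentPair.mono_mul_diff_pow, map_sum]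
    ext w
    rw [LinearMap.zero_apply, ← hid α (β + l₀ • Pi.single ⟨0, hm⟩ 1) I c (Pi.single j 1) w,
      LinearMap.sum_apply]
    refine Finset.sum_congr rfl fun i hi => ?_
    have hsum : ∀ δ : Fin m → ℤ, (∑ k : Fin m, (Pi.single j (1 : ℂ) : Fin m → ℂ) k •
        (Finsupp.single (δ, ∅, Sum.inl k) 1 : WSp m n)) =
          Finsupp.single (δ, ∅, Sum.inl j) 1 := by
      intro δ
      rw [Finset.sum_eq_single j (fun k _ hk => by simp [hk]) (by simp)]
      simp
    rw [hsum, sub_nsmul _ (Nat.lt_succ_iff.mp (Finset.mem_range.mp hi)), ← sub_eq_add_neg,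
      ← add_sub_assoc, map_smul]
    simp [LaurentPair.toEnd]
  rw [map_sum, LinearMap.sum_apply, TensorProduct.tmul_sum]
  refine Submodule.sum_mem _ fun j _ => ?_
  rw [map_smul, LinearMap.smul_apply, TensorProduct.tmul_smul]
  refine Submodule.smul_mem _ _ ?_
  have key := LaurentPair.toTensor_mono_mem (LaurentPair.diff_pow_mem_annIdeal hrep hzero)
    (le_sup_right (a := Submodule.span ℂ
            {z : WSp m n ⊗[ℂ] V | ∃ (α' : Fin m → ℤ) (I' : Finset (Fin n))
                (c' : Fin m ⊕ Fin n) (u : V),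
              (∑ i : Fin m, (α' i).natAbs) ≤ m * l₀ ∧
              z = (Finsupp.single (α', I', c') 1 : WSp m n) ⊗ₜ[ℂ] u})) I c j v
    (fun γ δ hγ => Submodule.mem_sup_left (Submodule.subset_span
      ⟨γ, I, c, _, hγ, by rw [LaurentPair.toTensor, LaurentPair.lift_mono]⟩)) α β
  rwa [LaurentPair.toTensor, LaurentPair.lift_mono] at key
end
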